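/- arXiv:1803.09233 — 3 statements merged into one kernel-verified Lean document; each statement's English description precedes it below -/
import Mathlib

section
/- Let (R, m, k) be a commutative noetherian local ring and let n ≥ 1. Then R is Tor-persistent if and only if the formal power series ring R[[X_1, …, X_n]] is Tor-persistent. -/
open CategoryTheory CategoryTheory.Limits

universe u

/-- An `R`-module `M` has finite projective dimension if it admits a projective
resolution that vanishes in all sufficiently high degrees. -/
def HasFiniteProjDim (R : Type u) [CommRing R] (M : ModuleCat.{u} R) : Prop :=
  ∃ (n : ℕ) (P : CategoryTheory.ProjectiveResolution M),
    ∀ i, n < i → IsZero (P.complex.X i)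

/-- A commutative ring `R` is Tor-persistent if every finitely generated `R`-module `M`
with `Tor_i^R(M, M) = 0` for all sufficiently large `i` has finite projective dimension. -/
def TorPersistent (R : Type u) [CommRing R] : Prop :=
  ∀ M : ModuleCat.{u} R, Module.Finite R M →
    (∃ N : ℕ, ∀ i, N ≤ i → Subsingleton (((Tor (ModuleCat.{u} R) i).obj M).obj M)) →
    HasFiniteProjDim R M

section Flat

lemma Module.Flat.pi_of_isNoetherianRing {R : Type*} [CommRing R] [IsNoetherianRing R]
    (ι : Type*) : Module.Flat R (ι → R) := by
  rw [Module.Flat.iff_forall_isTrivialRelation]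
  intro l f x hfx
  let φ : (Fin l → R) →ₗ[R] R := Fintype.linearCombination R f
  obtain ⟨k, y, hy⟩ := Submodule.fg_iff_exists_fin_generating_family.mp
    (IsNoetherian.noetherian (LinearMap.ker φ))
  have hmem (j : ι) : (fun i ↦ x i j) ∈ Submodule.span R (Set.range y) := by
    rw [hy, LinearMap.mem_ker, Fintype.linearCombination_apply]
    have := congrFun hfx j
    simpa [mul_comm] using this
  choose c hc using fun j ↦ (Submodule.mem_span_range_iff_exists_fun R).mp (hmem j)
  refine ⟨k, fun i s ↦ y s i, fun s j ↦ c j s, fun i ↦ ?_, fun s ↦ ?_⟩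
  · ext j
    have := congrFun (hc j) i
    simpa [mul_comm] using this.symm
  · have : y s ∈ LinearMap.ker φ := hy ▸ Submodule.subset_span ⟨s, rfl⟩
    rw [LinearMap.mem_ker, Fintype.linearCombination_apply] at this
    simpa [mul_comm] using this

instance {R σ : Type*} [CommRing R] [IsNoetherianRing R] : Module.Flat R (MvPowerSeries σ R) :=
  Module.Flat.pi_of_isNoetherianRing (σ →₀ ℕ)

end Flat

open scoped TensorProduct

section Resolutions

/-- A projective resolution of a module, in terms of linear maps. -/
structure LinearResolution (A : Type u) [CommRing A] (M : Type u) [AddCommGroup M]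
    [Module A M] where
  /-- the terms of the resolution -/
  X : ℕ → ModuleCat.{u} A
  /-- the differentials -/
  d : ∀ i, X (i + 1) →ₗ[A] X i
  /-- the augmentation -/
  ε : X 0 →ₗ[A] M
  projective : ∀ i, Module.Projective A (X i)
  exact_d : ∀ i, Function.Exact (d (i + 1)) (d i)
  exact_ε : Function.Exact (d 0) ε
  surjective_ε : Function.Surjective ε

namespace LinearResolution

variable {A : Type u} [CommRing A] {M : Type u} [AddCommGroup M] [Module A M]

/-- The linear resolution underlying a categorical projective resolution. -/
noncomputable def ofProjectiveResolution {M : ModuleCat.{u} A} (P : ProjectiveResolution M) :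
    LinearResolution A M where
  X := P.complex.X
  d i := (P.complex.d (i + 1) i).hom
  ε := (P.π.f 0).hom
  projective i := (IsProjective.iff_projective (R := A) (P.complex.X i)).mpr (P.projective i)
  exact_d i := (ShortComplex.ShortExact.moduleCat_exact_iff_function_exact _).mp (P.exact_succ i)
  exact_ε := (ShortComplex.ShortExact.moduleCat_exact_iff_function_exact
      (.mk _ _ P.complex_d_comp_π_f_zero)).mp P.exact₀
  surjective_ε := (ModuleCat.epi_iff_surjective (P.π.f 0)).mp inferInstance

variable (r : LinearResolution A M)

lemma d_comp_d (i : ℕ) : r.d i ∘ₗ r.d (i + 1) = 0 :=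
  (r.exact_d i).linearMap_comp_eq_zero

/-- The chain complex of a linear resolution. -/
noncomputable def complex : ChainComplex (ModuleCat.{u} A) ℕ :=
  ChainComplex.of r.X (fun i ↦ ModuleCat.ofHom (r.d i))
    (fun i ↦ by rw [← ModuleCat.ofHom_comp, d_comp_d]; rfl)

lemma complex_d (i : ℕ) : r.complex.d (i + 1) i = ModuleCat.ofHom (r.d i) :=
  ChainComplex.of_d r.X (fun i ↦ ModuleCat.ofHom (r.d i)) i

lemma ofHom_d_comp_ofHom_ε :
    (ModuleCat.ofHom (r.d 0) ≫ ModuleCat.ofHom r.ε : r.X 1 ⟶ ModuleCat.of A M) = 0 :=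
  ModuleCat.hom_ext r.exact_ε.linearMap_comp_eq_zero

lemma complex_d_comp_ofHom_ε : r.complex.d 1 0 ≫ (ModuleCat.ofHom r.ε : r.X 0 ⟶ _) = 0 :=
  (congrArg (fun f : r.X 1 ⟶ r.X 0 ↦ f ≫ ModuleCat.ofHom r.ε) (r.complex_d 0)).trans
    r.ofHom_d_comp_ofHom_ε

/-- The categorical projective resolution of a linear resolution. -/
noncomputable def toProjectiveResolution : ProjectiveResolution (ModuleCat.of A M) where
  complex := r.complex
  projective i := (IsProjective.iff_projective (R := A) (r.X i)).mp (r.projective i)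
  π := (ChainComplex.toSingle₀Equiv _ _).symm ⟨ModuleCat.ofHom r.ε, r.complex_d_comp_ofHom_ε⟩
  quasiIso := ⟨fun n ↦ by
    cases n with
    | zero =>
      rw [ChainComplex.quasiIsoAt₀_iff, ShortComplex.quasiIso_iff_of_zeros']
      · refine (ShortComplex.exact_and_epi_g_iff_of_iso
          (S₂ := .mk _ _ r.ofHom_d_comp_ofHom_ε) ?_).2
          ⟨(ShortComplex.ShortExact.moduleCat_exact_iff_function_exact _).mpr r.exact_ε,
            (ModuleCat.epi_iff_surjective (ModuleCat.ofHom r.ε)).mpr r.surjective_ε⟩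
        refine ShortComplex.isoMk (Iso.refl (r.X 1)) (Iso.refl (r.X 0))
          (Iso.refl (ModuleCat.of A M)) ?_ ?_
        · exact (Category.id_comp _).trans ((r.complex_d 0).symm.trans (Category.comp_id _).symm)
        · exact (Category.id_comp _).trans
            ((ChainComplex.toSingle₀Equiv_symm_apply_f_zero (C := r.complex)
              (X := ModuleCat.of A M) (ModuleCat.ofHom r.ε) r.complex_d_comp_ofHom_ε).symm.trans
                (Category.comp_id (Y := ModuleCat.of A M) _).symm)
      all_goals rfl
    | succ n =>
      rw [quasiIsoAt_iff_exactAt']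
      · rw [HomologicalComplex.exactAt_iff' _ (n + 1 + 1) (n + 1) n (by simp) (by simp)]
        refine (ShortComplex.ShortExact.moduleCat_exact_iff_function_exact _).mpr ?_
        have h := r.complex_d n
        have h' := r.complex_d (n + 1)
        simp only [HomologicalComplex.sc', HomologicalComplex.shortComplexFunctor']
        rw [h, h']
        exact r.exact_d n
      · exact ChainComplex.exactAt_succ_single_obj _ _⟩

open MonoidalCategory in
lemma subsingleton_tor_succ_iff (N : ModuleCat.{u} A) (r : LinearResolution A M) (i : ℕ) :
    Subsingleton (((Tor (ModuleCat.{u} A) (i + 1)).obj N).obj (ModuleCat.of A M)) ↔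
      Function.Exact ((r.d (i + 1)).lTensor N) ((r.d i).lTensor N) := by
  have e := r.toProjectiveResolution.isoLeftDerivedObj ((tensoringLeft (ModuleCat.{u} A)).obj N)
    (i + 1)
  rw [← ModuleCat.isZero_iff_subsingleton]
  refine (e.isZero_iff).trans ?_
  refine ((HomologicalComplex.exactAt_iff_isZero_homology _ _).symm).trans ?_
  rw [HomologicalComplex.exactAt_iff' _ (i + 1 + 1) (i + 1) i (by simp) (by simp)]
  refine (ShortComplex.ShortExact.moduleCat_exact_iff_function_exact _).trans ?_
  have h := r.complex_d i
  have h' := r.complex_d (i + 1)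
  simp only [HomologicalComplex.sc', HomologicalComplex.shortComplexFunctor',
    Functor.mapHomologicalComplex_obj_d, toProjectiveResolution]
  rw [h, h']
  rfl

/-- Splicing a resolution of `K` with a short exact sequence `0 → K → F → M → 0`. -/
noncomputable def splice {K : Type u} [AddCommGroup K] [Module A K] (r : LinearResolution A K)
    {F : Type u} [AddCommGroup F] [Module A F] [Module.Projective A F]
    (f : K →ₗ[A] F) (g : F →ₗ[A] M) (hf : Function.Injective f) (hfg : Function.Exact f g)
    (hg : Function.Surjective g) : LinearResolution A M where
  X
    | 0 => ModuleCat.of A F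
    | i + 1 => r.X i
  d
    | 0 => f ∘ₗ r.ε
    | i + 1 => r.d i
  ε := g
  projective
    | 0 => ‹_›
    | i + 1 => r.projective i
  exact_d
    | 0 => by
      intro x
      exact (map_eq_zero_iff f hf).trans (r.exact_ε x)
    | i + 1 => r.exact_d i
  exact_ε := by
    intro x
    rw [hfg x]
    simp only [LinearMap.coe_comp, r.surjective_ε.range_comp]
  surjective_ε := hg

/-- The tail of a resolution, as a resolution of the first syzygy. -/
noncomputable def tail : LinearResolution A (LinearMap.ker r.ε) where
  X i := r.X (i + 1)
  d i := r.d (i + 1)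
  ε := (r.d 0).codRestrict _ r.exact_ε.apply_apply_eq_zero
  projective i := r.projective (i + 1)
  exact_d i := r.exact_d (i + 1)
  exact_ε x := by
    rw [← r.exact_d 0 x]
    exact Subtype.ext_iff
  surjective_ε := by
    rintro ⟨x, hx⟩
    obtain ⟨y, rfl⟩ := (r.exact_ε x).mp hx
    exact ⟨y, rfl⟩

end LinearResolution

end Resolutions

section ProjectiveDimension

variable {A : Type u} [CommRing A]

lemma LinearResolution.hasProjectiveDimensionLT {M : Type u} [AddCommGroup M] [Module A M]
    (r : LinearResolution A M) (n : ℕ) (h : ∀ i, n < i → Subsingleton (r.X i)) :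
    HasProjectiveDimensionLT (ModuleCat.of A M) (n + 1) := by
  have hP (i : ℕ) : Projective (ModuleCat.of A (r.X i)) :=
    (IsProjective.iff_projective (R := A) (r.X i)).mp (r.projective i)
  induction n generalizing M with
  | zero =>
    have hinj : Function.Injective r.ε := by
      have := h 1 one_pos
      rw [injective_iff_map_eq_zero]
      intro x hx
      obtain ⟨y, rfl⟩ := (r.exact_ε x).mp hx
      rw [Subsingleton.elim y 0, map_zero]
    have := hP 0
    exact hasProjectiveDimensionLT_of_iso
      (LinearEquiv.ofBijective r.ε ⟨hinj, r.surjective_ε⟩).toModuleIso 1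
  | succ n ih =>
    refine ((LinearMap.shortExact_shortComplexKer
      r.surjective_ε).hasProjectiveDimensionLT_X₃_iff n (hP 0)).mpr ?_
    exact ih r.tail (fun i hi ↦ h (i + 1) (by omega)) (fun i ↦ hP (i + 1))

lemma LinearResolution.exists_of_hasProjectiveDimensionLT {M : Type u} [AddCommGroup M]
    [Module A M] (n : ℕ) (h : HasProjectiveDimensionLT (ModuleCat.of A M) (n + 1)) :
    ∃ r : LinearResolution A M, ∀ i, n < i → Subsingleton (r.X i) := by
  induction n generalizing M with
  | zero =>
    have hM : Module.Projective A M :=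
      (IsProjective.iff_projective (R := A) M).mpr inferInstance
    let zeroResolution : LinearResolution A PUnit.{u + 1} :=
      { X := fun _ ↦ ModuleCat.of A PUnit.{u + 1}
        d := fun _ ↦ 0
        ε := 0
        projective := fun _ ↦ inferInstanceAs (Module.Projective A PUnit.{u + 1})
        exact_d := fun _ x ↦ ⟨fun _ ↦ ⟨0, rfl⟩, fun _ ↦ rfl⟩
        exact_ε := fun x ↦ ⟨fun _ ↦ ⟨0, rfl⟩, fun _ ↦ rfl⟩
        surjective_ε := fun x ↦ ⟨0, rfl⟩ }
    refine ⟨zeroResolution.splice (0 : PUnit.{u + 1} →ₗ[A] M) LinearMap.id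
      (fun _ _ _ ↦ rfl) (fun x ↦ ⟨fun hx ↦ ⟨0, ?_⟩, ?_⟩) Function.surjective_id, ?_⟩
    · exact Eq.symm (a := x) hx
    · rintro ⟨_, rfl⟩
      rfl
    · rintro (_ | i) hi
      · omega
      · exact inferInstanceAs (Subsingleton PUnit)
  | succ n ih =>
    let g : (M →₀ A) →ₗ[A] M := Finsupp.linearCombination A id
    have hg : Function.Surjective g := Finsupp.linearCombination_id_surjective A M
    have hF : Projective (ModuleCat.of A (M →₀ A)) :=
      (IsProjective.iff_projective (R := A) (M →₀ A)).mp inferInstance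
    obtain ⟨r, hr⟩ := ih (((LinearMap.shortExact_shortComplexKer
      hg).hasProjectiveDimensionLT_X₃_iff n hF).mp h)
    refine ⟨r.splice (LinearMap.ker g).subtype g (Submodule.subtype_injective _)
      (LinearMap.exact_subtype_ker_map g) hg, ?_⟩
    rintro (_ | i) hi
    · omega
    · exact hr i (by omega)

lemma hasFiniteProjDim_iff (M : ModuleCat.{u} A) :
    HasFiniteProjDim A M ↔ ∃ n : ℕ, HasProjectiveDimensionLT M n := by
  constructor
  · rintro ⟨n, P, hP⟩
    exact ⟨n + 1, (LinearResolution.ofProjectiveResolution P).hasProjectiveDimensionLT n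
      fun i hi ↦ ModuleCat.isZero_iff_subsingleton.mp (hP i hi)⟩
  · rintro ⟨n, hn⟩
    obtain ⟨r, hr⟩ := LinearResolution.exists_of_hasProjectiveDimensionLT (M := M) n
      (hasProjectiveDimensionLT_of_ge M n (n + 1) n.le_succ)
    exact ⟨n, r.toProjectiveResolution,
      fun i hi ↦ ModuleCat.isZero_iff_subsingleton.mpr (hr i hi)⟩

end ProjectiveDimension

section BaseChange

variable {A : Type u} [CommRing A]

namespace LinearResolution

lemma eventually_subsingleton_tor_iff (N : ModuleCat.{u} A) {M : Type u} [AddCommGroup M]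
    [Module A M] (r : LinearResolution A M) :
    (∃ n : ℕ, ∀ i, n ≤ i →
      Subsingleton (((Tor (ModuleCat.{u} A) i).obj N).obj (ModuleCat.of A M))) ↔
    ∃ n : ℕ, ∀ i, n ≤ i → Function.Exact ((r.d (i + 1)).lTensor N) ((r.d i).lTensor N) := by
  constructor
  · rintro ⟨n, h⟩
    exact ⟨n, fun i hi ↦ (r.subsingleton_tor_succ_iff N i).mp (h (i + 1) (by omega))⟩
  · rintro ⟨n, h⟩
    refine ⟨n + 1, fun i hi ↦ ?_⟩
    obtain ⟨i, rfl⟩ := Nat.exists_eq_add_of_le' (show 1 ≤ i by omega)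
    exact (r.subsingleton_tor_succ_iff N i).mpr (h i (by omega))

/-- The base change of a resolution to an algebra over which it remains exact. -/
noncomputable def baseChange (B : Type u) [CommRing B] [Algebra A B] {M : Type u}
    [AddCommGroup M] [Module A M] (r : LinearResolution A M)
    (h : ∀ i, Function.Exact ((r.d (i + 1)).lTensor B) ((r.d i).lTensor B)) :
    LinearResolution B (B ⊗[A] M) where
  X i := ModuleCat.of B (B ⊗[A] r.X i)
  d i := (r.d i).baseChange B
  ε := r.ε.baseChange B
  projective i := by
    have := r.projective i
    exact inferInstanceAs (Module.Projective B (B ⊗[A] r.X i))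
  exact_d := h
  exact_ε := lTensor_exact B r.exact_ε r.surjective_ε
  surjective_ε := LinearMap.lTensor_surjective B r.surjective_ε

end LinearResolution

lemma exact_lTensor_baseChange (B : Type u) [CommRing B] [Algebra A B]
    (N : Type u) [AddCommGroup N] [Module A N] {X Y Z : Type u}
    [AddCommGroup X] [Module A X] [AddCommGroup Y] [Module A Y] [AddCommGroup Z] [Module A Z]
    (f : X →ₗ[A] Y) (g : Y →ₗ[A] Z)
    (h : Function.Exact ((f.lTensor N).lTensor B) ((g.lTensor N).lTensor B)) :
    Function.Exact ((f.baseChange B).lTensor (B ⊗[A] N)) ((g.baseChange B).lTensor (B ⊗[A] N)) := by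
  have comm {X Y : Type u} [AddCommGroup X] [Module A X] [AddCommGroup Y] [Module A Y]
      (f : X →ₗ[A] Y) :
      ((f.baseChange B).lTensor (B ⊗[A] N)) ∘ₗ
          (TensorProduct.AlgebraTensorModule.distribBaseChange A B N X).toLinearMap =
        (TensorProduct.AlgebraTensorModule.distribBaseChange A B N Y).toLinearMap ∘ₗ
          (f.lTensor N).baseChange B := by
    ext
    simp
  exact Function.Exact.of_ladder_linearEquiv_of_exact (comm f) (comm g)
    (show Function.Exact ((f.lTensor N).baseChange B) ((g.lTensor N).baseChange B) from h)

lemma hasProjectiveDimensionLT_baseChange_ker (B : Type u) [CommRing B] [Algebra A B]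
    {F M : Type u} [AddCommGroup F] [Module A F] [Module.Projective A F] [AddCommGroup M]
    [Module A M] (g : F →ₗ[A] M) (hg : Function.Surjective g)
    (hinj : Function.Injective ((LinearMap.ker g).subtype.lTensor B)) {n : ℕ}
    (h : HasProjectiveDimensionLT (ModuleCat.of B (B ⊗[A] M)) (n + 2)) :
    HasProjectiveDimensionLT (ModuleCat.of B (B ⊗[A] LinearMap.ker g)) (n + 1) := by
  have hex : Function.Exact ((LinearMap.ker g).subtype.baseChange B) (g.baseChange B) :=
    lTensor_exact B (LinearMap.exact_subtype_ker_map g) hg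
  let S : ShortComplex (ModuleCat.{u} B) :=
    ModuleCat.shortComplexOfCompEqZero _ _ hex.linearMap_comp_eq_zero
  have hS : S.ShortExact :=
    { exact := (ShortComplex.ShortExact.moduleCat_exact_iff_function_exact S).mpr hex
      mono_f := (ModuleCat.mono_iff_injective S.f).mpr hinj
      epi_g := (ModuleCat.epi_iff_surjective S.g).mpr (LinearMap.lTensor_surjective B hg) }
  have hF : Projective S.X₂ :=
    (IsProjective.iff_projective (R := B) (B ⊗[A] F)).mp inferInstance
  exact (hS.hasProjectiveDimensionLT_X₃_iff n hF).mp h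

end BaseChange

section Retract

variable {R A : Type u} [CommRing R] [CommRing A] [Algebra R A] [Algebra A R]
  [IsScalarTower R A R]

lemma hasProjectiveDimensionLT_of_baseChange_of_retract [Module.Flat R A]
    (n : ℕ) (M : Type u) [AddCommGroup M] [Module R M]
    (h : HasProjectiveDimensionLT (ModuleCat.of A (A ⊗[R] M)) (n + 1)) :
    HasProjectiveDimensionLT (ModuleCat.of R M) (n + 1) := by
  induction n generalizing M with
  | zero =>
    have : Module.Projective A (A ⊗[R] M) :=
      (IsProjective.iff_projective (R := A) (A ⊗[R] M)).mpr inferInstance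
    have : Module.Projective R M := .of_equiv
      ((TensorProduct.AlgebraTensorModule.cancelBaseChange R A R R M).trans
        (TensorProduct.lid R M))
    have : Projective (ModuleCat.of R M) := (IsProjective.iff_projective (R := R) M).mp this
    exact inferInstance
  | succ n ih =>
    let g : (M →₀ R) →ₗ[R] M := Finsupp.linearCombination R id
    have hg : Function.Surjective g := Finsupp.linearCombination_id_surjective R M
    have hF : Projective (ModuleCat.of R (M →₀ R)) :=
      (IsProjective.iff_projective (R := R) (M →₀ R)).mp inferInstance
    refine ((LinearMap.shortExact_shortComplexKer
      hg).hasProjectiveDimensionLT_X₃_iff n hF).mpr (ih _ ?_)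
    exact hasProjectiveDimensionLT_baseChange_ker A g hg
      (Module.Flat.lTensor_preserves_injective_linearMap _ (Submodule.subtype_injective _)) h

lemma TorPersistent.of_flat_of_isScalarTower [Module.Flat R A] (h : TorPersistent A) :
    TorPersistent R := by
  intro M hM hT
  let r := LinearResolution.ofProjectiveResolution (projectiveResolution M)
  let r' := r.baseChange A fun i ↦ Module.Flat.lTensor_exact A (r.exact_d i)
  obtain ⟨n, hn⟩ := (r.eventually_subsingleton_tor_iff M).mp hT
  obtain ⟨m, hm⟩ := (hasFiniteProjDim_iff _).mp <|
    h (ModuleCat.of A (A ⊗[R] M)) (inferInstanceAs (Module.Finite A (A ⊗[R] M))) <|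
      (r'.eventually_subsingleton_tor_iff (ModuleCat.of A (A ⊗[R] M))).mpr
        ⟨n, fun i hi ↦ exact_lTensor_baseChange A M (r.d (i + 1)) (r.d i)
          (Module.Flat.lTensor_exact A (hn i hi))⟩
  exact (hasFiniteProjDim_iff _).mpr ⟨m + 1, hasProjectiveDimensionLT_of_baseChange_of_retract
    (A := A) m M (hasProjectiveDimensionLT_of_ge _ m (m + 1) m.le_succ)⟩

end Retract

section Quotient

variable {A : Type u} [CommRing A] {x : A}

lemma exact_lTensor_quotient_span_singleton {C₃ C₂ C₁ C₀ : Type u}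
    [AddCommGroup C₃] [Module A C₃] [AddCommGroup C₂] [Module A C₂] [AddCommGroup C₁] [Module A C₁]
    [AddCommGroup C₀] [Module A C₀] {f : C₃ →ₗ[A] C₂} {g : C₂ →ₗ[A] C₁} {h : C₁ →ₗ[A] C₀}
    (hfg : Function.Exact f g) (hgh : Function.Exact g h) (hx : IsSMulRegular C₀ x) :
    Function.Exact (f.lTensor (A ⧸ Ideal.span {x})) (g.lTensor (A ⧸ Ideal.span {x})) :=
  Function.Exact.of_ladder_linearEquiv_of_exact
    (QuotSMulTop.equivQuotTensor_naturality x f).symm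
    (QuotSMulTop.equivQuotTensor_naturality x g).symm
    (QuotSMulTop.map_first_exact_on_four_term_exact_of_isSMulRegular_last hfg hgh hx)

lemma injective_lTensor_quotient_span_singleton {K F M : Type u} [AddCommGroup K] [Module A K]
    [AddCommGroup F] [Module A F] [AddCommGroup M] [Module A M] {f : K →ₗ[A] F} {g : F →ₗ[A] M}
    (hf : Function.Injective f) (hfg : Function.Exact f g) (hx : IsSMulRegular M x) :
    Function.Injective (f.lTensor (A ⧸ Ideal.span {x})) := by
  have h := exact_lTensor_quotient_span_singleton (f := (0 : PUnit.{u + 1} →ₗ[A] K))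
    ((LinearMap.exact_zero_iff_injective PUnit.{u + 1} f).mpr hf) hfg hx
  rw [LinearMap.lTensor_zero] at h
  exact (LinearMap.exact_zero_iff_injective _ _).mp h

lemma IsSMulRegular.of_projective (hx : IsSMulRegular A x) (P : Type u) [AddCommGroup P]
    [Module A P] [Module.Projective A P] : IsSMulRegular P x :=
  ((TensorProduct.rid A P).isSMulRegular_congr x).mp (hx.lTensor P)

lemma hasProjectiveDimensionLT_of_quotient_span_singleton [IsNoetherianRing A] [IsLocalRing A]
    (hx : IsSMulRegular A x) (hxm : x ∈ IsLocalRing.maximalIdeal A) (n : ℕ)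
    (M : Type u) [AddCommGroup M] [Module A M] [Module.Finite A M] (hM : IsSMulRegular M x)
    (h : HasProjectiveDimensionLT
      (ModuleCat.of (A ⧸ Ideal.span {x}) ((A ⧸ Ideal.span {x}) ⊗[A] M)) (n + 1)) :
    HasProjectiveDimensionLT (ModuleCat.of A M) (n + 1) := by
  induction n generalizing M with
  | zero =>
    have : Nontrivial (A ⧸ Ideal.span {x}) := Ideal.Quotient.nontrivial_iff.mpr fun h ↦
      hxm (Ideal.span_singleton_eq_top.mp h)
    have : IsLocalRing (A ⧸ Ideal.span {x}) :=
      .of_surjective' (Ideal.Quotient.mk (Ideal.span {x})) Ideal.Quotient.mk_surjective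
    have : Module.Projective (A ⧸ Ideal.span {x}) ((A ⧸ Ideal.span {x}) ⊗[A] M) :=
      (IsProjective.iff_projective (R := A ⧸ Ideal.span {x}) _).mpr inferInstance
    have : Module.Free (A ⧸ Ideal.span {x}) ((A ⧸ Ideal.span {x}) ⊗[A] M) :=
      Module.free_of_flat_of_isLocalRing
    have hfree : Module.Free (A ⧸ Ideal.span {x}) (QuotSMulTop x M) := .of_equiv
      ((QuotSMulTop.equivQuotTensor x M).extendScalarsOfSurjective
        Ideal.Quotient.mk_surjective).symm
    have : Module.FinitePresentation A M := Module.finitePresentation_of_finite A M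
    have : Module.Free A M := (Module.free_quotSMulTop_iff_free A M
      (IsLocalRing.maximalIdeal_le_jacobson _ hxm) hM).mp hfree
    have : Projective (ModuleCat.of A M) := (IsProjective.iff_projective (R := A) M).mp inferInstance
    exact inferInstance
  | succ n ih =>
    obtain ⟨m, g, hg⟩ := Module.Finite.exists_fin' A M
    have hF : IsSMulRegular (Fin m → A) x := .pi fun _ ↦ hx
    have hP : Projective (ModuleCat.of A (Fin m → A)) :=
      (IsProjective.iff_projective (R := A) (Fin m → A)).mp inferInstance
    refine ((LinearMap.shortExact_shortComplexKer
      hg).hasProjectiveDimensionLT_X₃_iff n hP).mpr (ih (LinearMap.ker g) (hF.submodule _ _) ?_)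
    exact hasProjectiveDimensionLT_baseChange_ker _ g hg
      (injective_lTensor_quotient_span_singleton (Submodule.subtype_injective _)
        (LinearMap.exact_subtype_ker_map g) hM) h

lemma exact_lTensor_of_exact_lTensor_cokernel {K F M : Type u} [AddCommGroup K] [Module A K]
    [AddCommGroup F] [Module A F] [Module.Flat A F] [AddCommGroup M] [Module A M]
    {f : K →ₗ[A] F} {g : F →ₗ[A] M} (hf : Function.Injective f) (hfg : Function.Exact f g)
    (hg : Function.Surjective g) {Q₃ Q₂ Q₁ Q₀ : Type u} [AddCommGroup Q₃] [Module A Q₃]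
    [AddCommGroup Q₂] [Module A Q₂] [AddCommGroup Q₁] [Module A Q₁] [AddCommGroup Q₀] [Module A Q₀]
    [Module.Flat A Q₁] {d₂ : Q₃ →ₗ[A] Q₂} {d₁ : Q₂ →ₗ[A] Q₁} {d₀ : Q₁ →ₗ[A] Q₀}
    (h₂₁ : Function.Exact d₂ d₁) (h₁₀ : Function.Exact d₁ d₀)
    (hM : Function.Exact (d₂.lTensor M) (d₁.lTensor M)) :
    Function.Exact (d₁.lTensor K) (d₀.lTensor K) := by
  have comm {P Q V W : Type u} [AddCommGroup P] [Module A P] [AddCommGroup Q] [Module A Q]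
      [AddCommGroup V] [Module A V] [AddCommGroup W] [Module A W]
      (d : P →ₗ[A] Q) (a : V →ₗ[A] W) (z : V ⊗[A] P) :
      a.rTensor Q (d.lTensor V z) = d.lTensor W (a.rTensor P z) :=
    (LinearMap.congr_fun (LinearMap.rTensor_comp_lTensor _ a d) z).trans
      (LinearMap.congr_fun (LinearMap.lTensor_comp_rTensor _ a d) z).symm
  have hF₁ := Module.Flat.lTensor_exact F h₁₀
  have hF₂ := Module.Flat.lTensor_exact F h₂₁
  intro z
  constructor
  · intro hz
    obtain ⟨w, hw⟩ := (hF₁ (f.rTensor Q₁ z)).mp (by rw [← comm, hz, map_zero])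
    obtain ⟨v', hv'⟩ := (hM (g.rTensor Q₂ w)).mp (by
      rw [← comm, hw]
      exact (rTensor_exact Q₁ hfg hg).apply_apply_eq_zero z)
    obtain ⟨v, rfl⟩ := LinearMap.rTensor_surjective Q₃ hg v'
    obtain ⟨y, hy⟩ := (rTensor_exact Q₂ hfg hg (w - d₂.lTensor F v)).mp (by
      rw [map_sub, comm, hv', sub_self])
    refine ⟨y, Module.Flat.rTensor_preserves_injective_linearMap (M := Q₁) f hf ?_⟩
    rw [comm, hy, map_sub, hF₂.apply_apply_eq_zero, sub_zero, hw]
  · rintro ⟨y, rfl⟩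
    rw [← LinearMap.comp_apply, ← LinearMap.lTensor_comp, h₁₀.linearMap_comp_eq_zero,
      LinearMap.lTensor_zero, LinearMap.zero_apply]

lemma exact_lTensor_baseChange_quotient_span_singleton {K : Type u} [AddCommGroup K] [Module A K]
    (hK : IsSMulRegular K x) {Q₃ Q₂ Q₁ Q₀ : Type u} [AddCommGroup Q₃] [Module A Q₃]
    [AddCommGroup Q₂] [Module A Q₂] [AddCommGroup Q₁] [Module A Q₁] [AddCommGroup Q₀] [Module A Q₀]
    [Module.Flat A Q₀] {d₂ : Q₃ →ₗ[A] Q₂} {d₁ : Q₂ →ₗ[A] Q₁} {d₀ : Q₁ →ₗ[A] Q₀}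
    (h₂₁ : Function.Exact (d₂.lTensor K) (d₁.lTensor K))
    (h₁₀ : Function.Exact (d₁.lTensor K) (d₀.lTensor K)) :
    Function.Exact ((d₂.baseChange (A ⧸ Ideal.span {x})).lTensor ((A ⧸ Ideal.span {x}) ⊗[A] K))
      ((d₁.baseChange (A ⧸ Ideal.span {x})).lTensor ((A ⧸ Ideal.span {x}) ⊗[A] K)) := by
  have hreg : IsSMulRegular (K ⊗[A] Q₀) x := hK.rTensor Q₀
  exact exact_lTensor_baseChange (A ⧸ Ideal.span {x}) K d₂ d₁
    (exact_lTensor_quotient_span_singleton h₂₁ h₁₀ hreg)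

lemma TorPersistent.of_quotient_span_singleton [IsNoetherianRing A] [IsLocalRing A]
    (hx : IsSMulRegular A x) (hxm : x ∈ IsLocalRing.maximalIdeal A)
    (h : TorPersistent (A ⧸ Ideal.span {x})) : TorPersistent A := by
  intro M hM hT
  obtain ⟨m, g, hg⟩ := Module.Finite.exists_fin' A M
  let K := LinearMap.ker g
  have hK : IsSMulRegular K x := (IsSMulRegular.pi fun _ ↦ hx).submodule K x
  have hgK := LinearMap.exact_subtype_ker_map g
  let r := LinearResolution.ofProjectiveResolution (projectiveResolution (ModuleCat.of A K))
  have hP (i : ℕ) : Module.Projective A (r.X i) := r.projective i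
  let rM := r.splice K.subtype g K.subtype_injective hgK hg
  obtain ⟨n, hn⟩ := (rM.eventually_subsingleton_tor_iff M).mp hT
  have hKK (i : ℕ) (hi : n ≤ i) :
      Function.Exact ((r.d (i + 1)).lTensor K) ((r.d i).lTensor K) :=
    exact_lTensor_of_exact_lTensor_cokernel K.subtype_injective hgK hg
      (r.exact_d (i + 1)) (r.exact_d i) (hn (i + 2) (by omega))
  let r' := r.baseChange (A ⧸ Ideal.span {x}) fun i ↦ by
    cases i with
    | zero => exact exact_lTensor_quotient_span_singleton (r.exact_d 0) r.exact_ε hK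
    | succ i =>
      exact exact_lTensor_quotient_span_singleton (r.exact_d (i + 1)) (r.exact_d i)
        (hx.of_projective (r.X i))
  obtain ⟨k, hk⟩ := (hasFiniteProjDim_iff _).mp <|
    h (ModuleCat.of _ ((A ⧸ Ideal.span {x}) ⊗[A] K))
      (inferInstanceAs (Module.Finite _ ((A ⧸ Ideal.span {x}) ⊗[A] K))) <|
      (r'.eventually_subsingleton_tor_iff _).mpr ⟨n + 1, fun i hi ↦ by
        obtain ⟨i, rfl⟩ := Nat.exists_eq_add_of_le' (show 1 ≤ i by omega)
        exact exact_lTensor_baseChange_quotient_span_singleton hK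
          (hKK (i + 1) (by omega)) (hKK i (by omega))⟩
  have hpd : HasProjectiveDimensionLT (ModuleCat.of A K) (k + 1) :=
    hasProjectiveDimensionLT_of_quotient_span_singleton hx hxm k K hK
      (hasProjectiveDimensionLT_of_ge _ k (k + 1) k.le_succ)
  have hF : Projective (ModuleCat.of A (Fin m → A)) :=
    (IsProjective.iff_projective (R := A) (Fin m → A)).mp inferInstance
  exact (hasFiniteProjDim_iff _).mpr ⟨k + 2, ((LinearMap.shortExact_shortComplexKer
    hg).hasProjectiveDimensionLT_X₃_iff k hF).mpr hpd⟩

lemma TorPersistent.of_ringEquiv {B : Type u} [CommRing B] (e : A ≃+* B) (h : TorPersistent A) :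
    TorPersistent B := by
  let _ : Algebra A B := e.toRingHom.toAlgebra
  let _ : Algebra B A := e.symm.toRingHom.toAlgebra
  have : IsScalarTower B A B := .of_algebraMap_eq fun b ↦ (e.apply_symm_apply b).symm
  have : Module.Flat B A := RingHom.Flat.of_bijective (f := e.symm.toRingHom) e.symm.bijective
  exact .of_flat_of_isScalarTower h

lemma TorPersistent.of_surjective [IsNoetherianRing A] [IsLocalRing A] {B : Type u} [CommRing B]
    (h : TorPersistent B) (f : A →+* B) (hf : Function.Surjective f) (hx : x ∈ nonZeroDivisors A)
    (hxm : x ∈ IsLocalRing.maximalIdeal A) (hker : RingHom.ker f = Ideal.span {x}) :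
    TorPersistent A :=
  .of_quotient_span_singleton (fun _ _ h ↦ (isRegular_iff_mem_nonZeroDivisors.mpr hx).left h) hxm <|
    h.of_ringEquiv ((Ideal.quotEquivOfEq hker.symm).trans
      (RingHom.quotientKerEquivOfSurjective hf)).symm

end Quotient

section PowerSeries

variable {R : Type u} [CommRing R]

lemma TorPersistent.of_mvPowerSeries [IsNoetherianRing R] {n : ℕ}
    (h : TorPersistent (MvPowerSeries (Fin n) R)) : TorPersistent R := by
  let _ : Algebra (MvPowerSeries (Fin n) R) R :=
    (MvPowerSeries.constantCoeff (σ := Fin n) (R := R)).toAlgebra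
  have : IsScalarTower R (MvPowerSeries (Fin n) R) R :=
    .of_algebraMap_eq fun a ↦ (MvPowerSeries.constantCoeff_C a).symm
  exact .of_flat_of_isScalarTower h

lemma MvPowerSeries.exists_surjective_ker_eq_span_X_zero (R : Type*) [CommRing R] (n : ℕ) :
    ∃ f : MvPowerSeries (Fin (n + 1)) R →+* MvPowerSeries (Fin n) R,
      Function.Surjective f ∧ RingHom.ker f = Ideal.span {X 0} := by
  let e : MvPowerSeries (Fin (n + 1)) R ≃+* PowerSeries (MvPowerSeries (Fin n) R) :=
    (finSuccEquiv R n).toRingEquiv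
  have hX : e (X 0) = PowerSeries.X := finSuccEquiv_X_zero ..
  refine ⟨(PowerSeries.constantCoeff (R := MvPowerSeries (Fin n) R)).comp e.toRingHom, ?_, ?_⟩
  · exact (PowerSeries.constantCoeff_surj (R := MvPowerSeries (Fin n) R)).comp e.surjective
  · ext p
    rw [RingHom.mem_ker, Ideal.mem_span_singleton, ← map_dvd_iff e, hX, PowerSeries.X_dvd_iff]
    rfl

lemma TorPersistent.mvPowerSeries [IsNoetherianRing R] [IsLocalRing R] (h : TorPersistent R)
    (n : ℕ) : TorPersistent (MvPowerSeries (Fin n) R) := by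
  induction n with
  | zero => exact h.of_ringEquiv (MvPowerSeries.isEmptyEquiv (Fin 0) R).toRingEquiv.symm
  | succ n ih =>
    have hmem : (MvPowerSeries.X 0 : MvPowerSeries (Fin (n + 1)) R) ∈
        IsLocalRing.maximalIdeal (MvPowerSeries (Fin (n + 1)) R) := by
      rw [IsLocalRing.mem_maximalIdeal, mem_nonunits_iff, MvPowerSeries.isUnit_iff_constantCoeff,
        MvPowerSeries.constantCoeff_X]
      exact not_isUnit_zero
    obtain ⟨f, hf, hker⟩ := MvPowerSeries.exists_surjective_ker_eq_span_X_zero R n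
    exact ih.of_surjective f hf MvPowerSeries.X_mem_nonzeroDivisors hmem hker

end PowerSeries

/-- A commutative noetherian local ring `R` is Tor-persistent if and only if the formal
power series ring `R[[X₁, …, Xₙ]]` is Tor-persistent (`n ≥ 1`). -/
theorem torPersistent_iff_mvPowerSeries
    {R : Type u} [CommRing R] [IsNoetherianRing R] [IsLocalRing R]
    (n : ℕ) (hn : 1 ≤ n) :
    TorPersistent R ↔ TorPersistent (MvPowerSeries (Fin n) R) :=
  ⟨fun h ↦ h.mvPowerSeries n, TorPersistent.of_mvPowerSeries⟩
end

section
/- Let k be a field. The local ring A = k[[X, Y, U, V, W]]/(X⁴, Y³, XY, Y² + U³ + UV + V, X² + UV² + W + W²) is Tor-persistent. -/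
open CategoryTheory CategoryTheory.Limits

universe u

section TensorVanishing

open TensorProduct

variable {A : Type*} [CommRing A]

/-- The corestriction of a differential to the next syzygy. -/
theorem exists_lift_ker_of_ker_eq_range {E F G : Type*}
    [AddCommGroup E] [AddCommGroup F] [AddCommGroup G] [Module A E] [Module A F] [Module A G]
    (c : F →ₗ[A] E) (d : G →ₗ[A] F) (hex : LinearMap.ker c = LinearMap.range d) :
    ∃ d' : G →ₗ[A] LinearMap.ker c, (LinearMap.ker c).subtype ∘ₗ d' = d ∧
      Function.Surjective d' ∧ Function.Exact (LinearMap.ker d).subtype d' := by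
  refine ⟨d.codRestrict _ fun v ↦ hex ▸ LinearMap.mem_range_self d v, rfl, ?_, fun v ↦ ?_⟩
  · rintro ⟨v, hv⟩
    rw [hex] at hv
    obtain ⟨w, rfl⟩ := hv
    exact ⟨w, rfl⟩
  · rw [← LinearMap.exact_subtype_ker_map d v]
    exact ⟨fun hv ↦ congrArg Subtype.val hv, fun hv ↦ Subtype.ext hv⟩

/-- Dimension shifting: vanishing of a first `Tor` passes from the second syzygy in one variable to
the first syzygy in both variables. -/
theorem lTensor_subtype_ker_injective_of_lTensor {F G H N Q : Type*}
    [AddCommGroup F] [AddCommGroup G] [AddCommGroup H] [AddCommGroup N] [AddCommGroup Q]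
    [Module A F] [Module A G] [Module A H] [Module A N] [Module A Q]
    [Module.Flat A F] [Module.Flat A G] [Module.Flat A H] [Module.Flat A Q]
    (d : G →ₗ[A] F) (e : H →ₗ[A] G) (hex : LinearMap.ker d = LinearMap.range e)
    (f : Q →ₗ[A] N) (hf : Function.Surjective f)
    (h : Function.Injective ((LinearMap.ker e).subtype.lTensor N)) :
    Function.Injective ((LinearMap.ker d).subtype.lTensor (LinearMap.ker f)) := by
  rw [injective_iff_map_eq_zero]
  intro t ht
  have hexf : Function.Exact (LinearMap.ker f).subtype f := LinearMap.exact_subtype_ker_map f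
  obtain ⟨e', hcomp, he', hexe⟩ := exists_lift_ker_of_ker_eq_range d e hex
  obtain ⟨t', rfl⟩ := LinearMap.lTensor_surjective (LinearMap.ker f) he' t
  -- the lifted tensor has zero image in `Q ⊗ ker d`
  have h1 : e'.lTensor Q ((LinearMap.ker f).subtype.rTensor H t') = 0 := by
    apply Module.Flat.lTensor_preserves_injective_linearMap (M := Q) _ (LinearMap.ker d).injective_subtype
    rw [map_zero, ← LinearMap.comp_apply, ← LinearMap.lTensor_comp, hcomp]
    rw [← LinearMap.comp_apply, ← LinearMap.lTensor_comp, hcomp] at ht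
    rw [← LinearMap.comp_apply, LinearMap.lTensor_comp_rTensor, ← LinearMap.rTensor_comp_lTensor,
      LinearMap.comp_apply, ht, map_zero]
  obtain ⟨s, hs⟩ := (lTensor_exact Q hexe he' _).1 h1
  have h2 : f.rTensor _ s = 0 := by
    apply h
    rw [map_zero, ← LinearMap.comp_apply, LinearMap.lTensor_comp_rTensor,
      ← LinearMap.rTensor_comp_lTensor, LinearMap.comp_apply, hs, ← LinearMap.comp_apply,
      ← LinearMap.rTensor_comp, hexf.linearMap_comp_eq_zero]
    simp
  obtain ⟨r, rfl⟩ := (rTensor_exact _ hexf hf _).1 h2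
  have h3 : t' = (LinearMap.ker e).subtype.lTensor _ r := by
    apply Module.Flat.rTensor_preserves_injective_linearMap (M := H) _ (LinearMap.ker f).injective_subtype
    rw [← hs, ← LinearMap.comp_apply, ← LinearMap.comp_apply, LinearMap.lTensor_comp_rTensor,
      LinearMap.rTensor_comp_lTensor]
  rw [h3, ← LinearMap.comp_apply, ← LinearMap.lTensor_comp, hexe.linearMap_comp_eq_zero]
  simp

/-- A minimal generator is detected by a linear map to the residue field. -/
theorem exists_residueField_apply_ne_zero [IsLocalRing A] {M : Type*} [AddCommGroup M] [Module A M]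
    {v : M} (hv : v ∉ IsLocalRing.maximalIdeal A • (⊤ : Submodule A M)) :
    ∃ φ : M →ₗ[A] IsLocalRing.ResidueField A, φ v ≠ 0 := by
  have hv' : Submodule.Quotient.mk (p := IsLocalRing.maximalIdeal A • (⊤ : Submodule A M)) v ≠ 0 := by
    rwa [Ne, Submodule.Quotient.mk_eq_zero]
  let : Module (IsLocalRing.ResidueField A)
      (M ⧸ (IsLocalRing.maximalIdeal A • (⊤ : Submodule A M))) :=
    inferInstanceAs (Module (A ⧸ IsLocalRing.maximalIdeal A) _)
  have : IsScalarTower A (IsLocalRing.ResidueField A)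
      (M ⧸ (IsLocalRing.maximalIdeal A • (⊤ : Submodule A M))) :=
    inferInstanceAs (IsScalarTower A (A ⧸ IsLocalRing.maximalIdeal A) _)
  obtain ⟨φ, hφ⟩ := Module.Projective.exists_dual_ne_zero (IsLocalRing.ResidueField A) hv'
  exact ⟨φ.restrictScalars A ∘ₗ Submodule.mkQ _, hφ⟩

/-- Tensors of minimal generators do not vanish modulo the maximal ideal. -/
theorem tmul_ne_smul [IsLocalRing A] {M N : Type*} [AddCommGroup M] [AddCommGroup N]
    [Module A M] [Module A N] {v : M} {w : N} {t : A} (ht : t ∈ IsLocalRing.maximalIdeal A)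
    (hv : v ∉ IsLocalRing.maximalIdeal A • (⊤ : Submodule A M))
    (hw : w ∉ IsLocalRing.maximalIdeal A • (⊤ : Submodule A N)) (s : M ⊗[A] N) :
    v ⊗ₜ w ≠ t • s := by
  obtain ⟨φ, hφ⟩ := exists_residueField_apply_ne_zero hv
  obtain ⟨ψ, hψ⟩ := exists_residueField_apply_ne_zero hw
  intro h
  have := congrArg (LinearMap.mul' A (IsLocalRing.ResidueField A) ∘ₗ TensorProduct.map φ ψ) h
  rw [map_smul, Algebra.smul_def] at this
  simp [(IsLocalRing.residue_eq_zero_iff t).2 ht, hφ, hψ] at this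

/-- Incompatible minimal generators contradict vanishing of `Tor`. -/
theorem false_of_lTensor_injective [IsLocalRing A] {E F G L : Type*}
    [AddCommGroup E] [AddCommGroup F] [AddCommGroup G] [AddCommGroup L]
    [Module A E] [Module A F] [Module A G] [Module A L] [Module.Flat A F]
    (c : F →ₗ[A] E) (d : G →ₗ[A] F) (hex : LinearMap.ker c = LinearMap.range d) {y t : A}
    (ht : t ∈ IsLocalRing.maximalIdeal A) (hL : ∀ v : L, t • v = 0 → v = 0)
    (hc : Function.Injective ((LinearMap.ker c).subtype.lTensor L))
    (hd : Function.Injective ((LinearMap.ker d).subtype.lTensor L))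
    {v v' : L} (hv : v ∉ IsLocalRing.maximalIdeal A • (⊤ : Submodule A L)) (hvv : y • v = t • v')
    (h : ∃ z ∈ LinearMap.ker d, z ∉ IsLocalRing.maximalIdeal A • LinearMap.ker d ∧
      ∃ a p, z = y • a + t • p) : False := by
  obtain ⟨z, hz, hzm, a, p, rfl⟩ := h
  obtain ⟨d', hcomp, hd', hexd⟩ := exists_lift_ker_of_ker_eq_range c d hex
  have hτ : (LinearMap.ker d).subtype.lTensor L (v ⊗ₜ ⟨y • a + t • p, hz⟩) =
      t • (v' ⊗ₜ a + v ⊗ₜ p) := by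
    rw [LinearMap.lTensor_tmul, Submodule.subtype_apply, tmul_add, tmul_smul,
      tmul_smul, smul_tmul' y, hvv, ← smul_tmul', ← smul_add]
  have h0 : d.lTensor L (v' ⊗ₜ a + v ⊗ₜ p) = 0 := by
    have hinj : Function.Injective (LinearMap.lsmul A L t) :=
      (injective_iff_map_eq_zero _).2 hL
    apply Module.Flat.rTensor_preserves_injective_linearMap (M := F) _ hinj
    have : (LinearMap.lsmul A L t).rTensor F = LinearMap.lsmul A _ t := by
      ext; simp [smul_tmul']
    rw [this, map_zero, LinearMap.lsmul_apply, ← map_smul, ← hτ, ← LinearMap.comp_apply,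
      ← LinearMap.lTensor_comp, (LinearMap.exact_subtype_ker_map d).linearMap_comp_eq_zero]
    simp
  have h1 : d'.lTensor L (v' ⊗ₜ a + v ⊗ₜ p) = 0 := by
    apply hc
    rw [map_zero, ← LinearMap.comp_apply, ← LinearMap.lTensor_comp, hcomp, h0]
  obtain ⟨s, hs⟩ := (lTensor_exact L hexd hd' _).1 h1
  refine tmul_ne_smul ht hv (w := ⟨y • a + t • p, hz⟩) (fun hmem ↦ hzm ?_) s ?_
  · exact (Submodule.mem_smul_top_iff _ _ _).1 hmem
  · apply hd
    rw [hτ, map_smul, hs]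

/-- Exactness of a tensored complex in terms of its syzygies. -/
theorem lTensor_subtype_ker_injective_of_exact {E F G H N : Type*}
    [AddCommGroup E] [AddCommGroup F] [AddCommGroup G] [AddCommGroup H] [AddCommGroup N]
    [Module A E] [Module A F] [Module A G] [Module A H] [Module A N]
    (c : F →ₗ[A] E) (d : G →ₗ[A] F) (e : H →ₗ[A] G)
    (hcd : LinearMap.ker c = LinearMap.range d) (hde : LinearMap.ker d = LinearMap.range e)
    (h : Function.Exact (e.lTensor N) (d.lTensor N)) :
    Function.Injective ((LinearMap.ker c).subtype.lTensor N) := by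
  rw [injective_iff_map_eq_zero]
  intro τ hτ
  obtain ⟨d', hcomp, hd', -⟩ := exists_lift_ker_of_ker_eq_range c d hcd
  have h0 : d' ∘ₗ e = 0 := by
    ext v
    have : e v ∈ LinearMap.ker d := hde ▸ LinearMap.mem_range_self e v
    exact (LinearMap.congr_fun hcomp (e v)).trans this
  obtain ⟨σ, rfl⟩ := LinearMap.lTensor_surjective N hd' τ
  rw [← LinearMap.comp_apply, ← LinearMap.lTensor_comp, hcomp] at hτ
  obtain ⟨ρ, rfl⟩ := (h _).1 hτ
  rw [← LinearMap.comp_apply, ← LinearMap.lTensor_comp, h0]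
  simp

end TensorVanishing


section LocalAlgebra

open IsLocalRing

variable {A : Type u} [CommRing A] [IsLocalRing A]

/-- A finitely generated module over a local ring has a minimal free cover. -/
theorem exists_minimal_free_cover (M : Type*) [AddCommGroup M] [Module A M] [Module.Finite A M] :
    ∃ (n : ℕ) (f : (Fin n → A) →ₗ[A] M), Function.Surjective f ∧
      ∀ g, f g = 0 → ∀ i, g i ∈ maximalIdeal A := by
  classical
  have hex : ∃ n : ℕ, ∃ f : (Fin n → A) →ₗ[A] M, Function.Surjective f :=
    Module.Finite.exists_fin' A M
  obtain ⟨f, hf⟩ := Nat.find_spec hex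
  refine ⟨Nat.find hex, f, hf, fun g hg i ↦ ?_⟩
  by_contra hi
  rw [mem_maximalIdeal, mem_nonunits_iff, not_not] at hi
  obtain ⟨c, hc⟩ := hi.exists_left_inv
  have hmin := fun m (hm : m < Nat.find hex) ↦ Nat.find_min hex hm
  generalize Nat.find hex = n at *
  obtain _ | n := n
  · exact i.elim0
  refine hmin n (Nat.lt_succ_self n)
    ⟨f ∘ₗ
      { toFun := fun v ↦ i.insertNth 0 v
        map_add' := fun v w ↦ ?_
        map_smul' := fun r v ↦ ?_ }, fun m ↦ ?_⟩
  · ext j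
    refine Fin.succAboveCases i ?_ (fun j ↦ ?_) j <;> simp
  · ext j
    refine Fin.succAboveCases i ?_ (fun j ↦ ?_) j <;> simp
  · obtain ⟨w, rfl⟩ := hf m
    refine ⟨fun j ↦ (w - (w i * c) • g) (i.succAbove j), ?_⟩
    have : (i.insertNth 0 fun j ↦ (w - (w i * c) • g) (i.succAbove j) : Fin (n + 1) → A) =
        w - (w i * c) • g := by
      ext j
      refine Fin.succAboveCases i ?_ (fun j ↦ ?_) j
      · simp [mul_assoc, hc]
      · simp
    have h2 : f (w - (w i * c) • g) = f w := by simp [hg]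
    rw [← h2]
    exact congrArg f this

omit [IsLocalRing A] in
theorem mem_smul_top_of_forall_mem {n : ℕ} (I : Ideal A) (e : Fin n → A) (he : ∀ i, e i ∈ I) :
    e ∈ I • (⊤ : Submodule A (Fin n → A)) := by
  rw [pi_eq_sum_univ' e]
  exact Submodule.sum_mem _ fun i _ ↦ Submodule.smul_mem_smul (he i) trivial

omit [IsLocalRing A] in
theorem apply_mem_sq_of_mem_smul {n : ℕ} (I : Ideal A) {Z : Submodule A (Fin n → A)}
    (hZ : ∀ z ∈ Z, ∀ i, z i ∈ I) {z : Fin n → A} (hz : z ∈ I • Z) (i : Fin n) :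
    z i ∈ I ^ 2 := by
  induction hz using Submodule.smul_induction_on' with
  | smul r hr w hw =>
    rw [pow_two]
    exact Ideal.mul_mem_mul hr (hZ w hw i)
  | add a _ b _ ha hb => exact Ideal.add_mem _ ha hb

variable {l m n : ℕ} {x y t : A}

/-- Splitting of a second syzygy modulo the regular element `t`. -/
theorem exists_mem_ker_notMem_smul [IsNoetherianRing A] (hm : maximalIdeal A = Ideal.span {x, y, t})
    (hxy : x * y = 0)
    (ht : ∀ a, t * a = 0 → a = 0) (hb : ∀ a b c, x * a + y * b = t * c → ∃ d, x * a = t * d)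
    (d' : (Fin m → A) →ₗ[A] (Fin l → A)) (d : (Fin n → A) →ₗ[A] (Fin m → A))
    (hex : LinearMap.ker d' = LinearMap.range d)
    (hd' : ∀ z ∈ LinearMap.ker d', ∀ i, z i ∈ maximalIdeal A)
    (hd : ∀ z ∈ LinearMap.ker d, ∀ i, z i ∈ maximalIdeal A)
    (hne : LinearMap.ker d ≠ ⊥) :
    ∃ z ∈ LinearMap.ker d, z ∉ maximalIdeal A • LinearMap.ker d ∧
      ((∃ a p, z = x • a + t • p) ∨ (∃ a p, z = y • a + t • p)) := by
  have tf : ∀ {n : ℕ} (v : Fin n → A), t • v = 0 → v = 0 := fun v hv ↦ by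
    ext i; exact ht _ (congrFun hv i)
  have decomp : ∀ {n : ℕ} (v : Fin n → A), (∀ i, v i ∈ maximalIdeal A) →
      ∃ a b c, v = x • a + y • b + t • c := by
    intro n v hv
    have : ∀ i, ∃ a b c, v i = x * a + y * b + t * c := by
      intro i
      have := hv i
      rw [hm, Ideal.mem_span_insert] at this
      obtain ⟨a, z, hz, h⟩ := this
      rw [Ideal.mem_span_pair] at hz
      obtain ⟨b, c, rfl⟩ := hz
      exact ⟨a, b, c, by rw [h]; ring⟩
    choose a b c h using this
    exact ⟨a, b, c, by ext i; simp [h]⟩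
  have key : ∀ v, t • v ∈ LinearMap.range d → v ∈ LinearMap.range d := by
    intro v hv
    rw [← hex, LinearMap.mem_ker, map_smul] at hv
    rw [← hex, LinearMap.mem_ker]
    exact tf _ hv
  by_contra! hcon
  apply hne
  have htm : t ∈ maximalIdeal A := by rw [hm]; exact Ideal.subset_span (by simp)
  refine Submodule.eq_bot_of_le_smul_of_le_jacobson_bot (maximalIdeal A) _
    (IsNoetherian.noetherian _) ?_ (maximalIdeal_le_jacobson _)
  intro g hg
  obtain ⟨a, b, c, rfl⟩ := decomp g (hd g hg)
  have im : ∀ a, ∃ p q r, d a = x • p + y • q + t • r := fun a ↦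
    decomp _ (hd' _ (hex ▸ LinearMap.mem_range_self d a))
  obtain ⟨p, q, r, h1⟩ := im a
  obtain ⟨p', q', r', h2⟩ := im b
  rw [LinearMap.mem_ker, map_add, map_add, map_smul, map_smul, map_smul, h1, h2] at hg
  have hs : ∃ s, x • x • p = t • s := by
    have : ∀ i, ∃ s, x * (x * p i) = t * s := by
      intro i
      have := congrFun hg i
      simp only [Pi.add_apply, Pi.smul_apply, smul_eq_mul, Pi.zero_apply] at this
      exact hb _ (y * q' i) (-(x * r i + y * r' i + d c i))
        (by linear_combination this - (q i + p' i) * hxy)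
    choose s hs using this
    exact ⟨s, by ext i; simpa using hs i⟩
  obtain ⟨s, hs⟩ := hs
  have e1 : d (x • a) = t • (s + x • r) := by
    rw [map_smul, h1]
    ext i
    have := congrFun hs i
    simp only [Pi.add_apply, Pi.smul_apply, smul_eq_mul] at this ⊢
    linear_combination this + q i * hxy
  obtain ⟨p1, hp1⟩ := key (s + x • r) (e1 ▸ LinearMap.mem_range_self d _)
  have k1 : x • a + t • (-p1) ∈ LinearMap.ker d := by
    rw [LinearMap.mem_ker, map_add, e1, map_smul, map_neg, hp1]; simp
  have e2 : d (y • b) = t • (- (s + x • r) - d c) := by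
    rw [← h1, ← h2, ← map_smul, ← map_smul, e1] at hg
    rw [smul_sub, smul_neg, ← sub_eq_zero, ← hg]
    abel
  obtain ⟨p2, hp2⟩ := key _ (e2 ▸ LinearMap.mem_range_self d _)
  have k2 : y • b + t • (-p2) ∈ LinearMap.ker d := by
    rw [LinearMap.mem_ker, map_add, e2, map_smul, map_neg, hp2, smul_neg, add_neg_cancel]
  have k3 : c + p1 + p2 ∈ LinearMap.ker d := by
    rw [LinearMap.mem_ker, map_add, map_add, hp1, hp2]; abel
  have := Submodule.add_mem _ (Submodule.add_mem _
    (by_contra fun h ↦ (hcon _ k1 h).1 _ _ rfl) (by_contra fun h ↦ (hcon _ k2 h).2 _ _ rfl))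
    (Submodule.smul_mem_smul htm k3)
  convert this using 1
  simp only [smul_add, smul_neg]
  abel

/-- Alternation of minimal generators along consecutive syzygies. -/
theorem exists_mem_ker_succ
    (hxy : x * y = 0) (ht : ∀ a, t * a = 0 → a = 0)
    (hy : y ∉ maximalIdeal A ^ 2 ⊔ Ideal.span {t})
    (d : (Fin m → A) →ₗ[A] (Fin l → A)) (e : (Fin n → A) →ₗ[A] (Fin m → A))
    (hex : LinearMap.ker d = LinearMap.range e)
    (he : ∀ z ∈ LinearMap.ker e, ∀ i, z i ∈ maximalIdeal A)
    (h : ∃ z ∈ LinearMap.ker d, z ∉ maximalIdeal A • LinearMap.ker d ∧ ∃ a p, z = x • a + t • p) :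
    ∃ z ∈ LinearMap.ker e, z ∉ maximalIdeal A • LinearMap.ker e ∧ ∃ a p, z = y • a + t • p := by
  obtain ⟨z, hz, hzm, a, p, rfl⟩ := h
  have hyz : y • (x • a + t • p) = t • y • p := by
    rw [smul_add, smul_smul, mul_comm y x, hxy, zero_smul, zero_add, smul_comm]
  have hyp : y • p ∈ LinearMap.ker d := by
    have := Submodule.smul_mem _ y hz
    rw [hyz, LinearMap.mem_ker, map_smul] at this
    ext i
    exact ht _ (congrFun this i)
  rw [hex] at hz hyp
  obtain ⟨v, hv⟩ := hz
  obtain ⟨w, hw⟩ := hyp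
  refine ⟨y • v + t • (-w), ?_, fun hmem ↦ ?_, v, -w, rfl⟩
  · rw [LinearMap.mem_ker, map_add, map_smul, map_smul, map_neg, hv, hw, hyz]; simp
  · have : ∃ i, v i ∉ maximalIdeal A := by
      by_contra! hv'
      apply hzm
      rw [← hv, hex, LinearMap.range_eq_map, ← Submodule.map_smul'']
      exact Submodule.mem_map_of_mem (mem_smul_top_of_forall_mem _ _ hv')
    obtain ⟨i, hi⟩ := this
    rw [mem_maximalIdeal, mem_nonunits_iff, not_not] at hi
    obtain ⟨c, hc⟩ := hi.exists_left_inv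
    apply hy
    have h1 := apply_mem_sq_of_mem_smul _ he hmem i
    have h2 : y = c * ((y • v + t • (-w)) i) + c * w i * t := by
      simp only [Pi.add_apply, Pi.smul_apply, smul_eq_mul, Pi.neg_apply]
      linear_combination -y * hc
    rw [h2]
    exact Submodule.add_mem_sup (Ideal.mul_mem_left _ _ h1)
      (Ideal.mul_mem_left _ _ (Ideal.mem_span_singleton_self t))

end LocalAlgebra

section Resolution

variable {A : Type u} [CommRing A]

/-- An exact sequence of finite free modules, viewed as a chain complex in `ModuleCat`. -/
noncomputable def freeComplex (n : ℕ → ℕ)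
    (d : ∀ j, (Fin (n (j + 1)) → A) →ₗ[A] (Fin (n j) → A))
    (hd : ∀ j, LinearMap.ker (d j) = LinearMap.range (d (j + 1))) :
    ChainComplex (ModuleCat.{u} A) ℕ :=
  ChainComplex.of (fun j ↦ ModuleCat.of A (Fin (n j) → A))
    (fun j ↦ ModuleCat.ofHom (d j)) fun j ↦ by
      rw [← ModuleCat.ofHom_comp, (LinearMap.exact_iff.2 (hd j)).linearMap_comp_eq_zero]
      rfl

theorem freeComplex_d (n : ℕ → ℕ) (d : ∀ j, (Fin (n (j + 1)) → A) →ₗ[A] (Fin (n j) → A))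
    (hd : ∀ j, LinearMap.ker (d j) = LinearMap.range (d (j + 1))) (j : ℕ) :
    (freeComplex n d hd).d (j + 1) j = ModuleCat.ofHom (d j) :=
  ChainComplex.of_d (V := ModuleCat.{u} A) (fun j ↦ ModuleCat.of A (Fin (n j) → A))
    (fun j ↦ ModuleCat.ofHom (d j)) j

/-- A resolution by finite free modules, viewed as a projective resolution in `ModuleCat`. -/
noncomputable def freeResolution (M : ModuleCat.{u} A) (n : ℕ → ℕ)
    (ε : (Fin (n 0) → A) →ₗ[A] M) (d : ∀ j, (Fin (n (j + 1)) → A) →ₗ[A] (Fin (n j) → A))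
    (hε : Function.Surjective ε) (h0 : LinearMap.ker ε = LinearMap.range (d 0))
    (hd : ∀ j, LinearMap.ker (d j) = LinearMap.range (d (j + 1))) : ProjectiveResolution M where
  complex := freeComplex n d hd
  projective j := (ModuleCat.of A (Fin (n j) → A)).projective_of_categoryTheory_projective
  π := (ChainComplex.toSingle₀Equiv _ _).symm ⟨ModuleCat.ofHom ε, by
    rw [freeComplex_d]
    exact ModuleCat.hom_ext (LinearMap.exact_iff.2 h0).linearMap_comp_eq_zero⟩
  quasiIso := ⟨fun j ↦ by
    obtain _ | j := j
    · have e := congrArg ModuleCat.Hom.hom (ChainComplex.toSingle₀Equiv_symm_apply_f_zero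
        (C := freeComplex n d hd) (ModuleCat.ofHom ε) (by
          rw [freeComplex_d]
          exact ModuleCat.hom_ext (LinearMap.exact_iff.2 h0).linearMap_comp_eq_zero))
      rw [ChainComplex.quasiIsoAt₀_iff, ShortComplex.quasiIso_iff_of_zeros' _ rfl rfl rfl]
      constructor
      · rw [ShortComplex.moduleCat_exact_iff_range_eq_ker]
        exact Eq.trans (congrArg LinearMap.range (congrArg ModuleCat.Hom.hom
          (freeComplex_d n d hd 0))) (h0.symm.trans (congrArg LinearMap.ker e.symm))
      · rw [ModuleCat.epi_iff_range_eq_top]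
        exact (congrArg LinearMap.range e).trans (LinearMap.range_eq_top.2 hε)
    · rw [quasiIsoAt_iff_exactAt']
      · rw [HomologicalComplex.exactAt_iff' _ (j + 1 + 1) (j + 1) j (by simp) (by simp),
          ShortComplex.moduleCat_exact_iff_range_eq_ker]
        exact Eq.trans (congrArg LinearMap.range (congrArg ModuleCat.Hom.hom
          (freeComplex_d n d hd (j + 1)))) ((hd j).symm.trans
            (congrArg LinearMap.ker (congrArg ModuleCat.Hom.hom (freeComplex_d n d hd j).symm)))
      · apply ChainComplex.exactAt_succ_single_obj⟩

theorem lTensor_exact_of_subsingleton_tor (M N : ModuleCat.{u} A) (n : ℕ → ℕ)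
    (ε : (Fin (n 0) → A) →ₗ[A] M) (d : ∀ j, (Fin (n (j + 1)) → A) →ₗ[A] (Fin (n j) → A))
    (hε : Function.Surjective ε) (h0 : LinearMap.ker ε = LinearMap.range (d 0))
    (hd : ∀ j, LinearMap.ker (d j) = LinearMap.range (d (j + 1))) (j : ℕ)
    (h : Subsingleton (((Tor (ModuleCat.{u} A) (j + 1)).obj N).obj M)) :
    Function.Exact ((d (j + 1)).lTensor N) ((d j).lTensor N) := by
  have hz := (@ModuleCat.isZero_of_subsingleton _ _ _ h).of_iso
    ((freeResolution M n ε d hε h0 hd).isoLeftDerivedObj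
      ((MonoidalCategory.tensoringLeft (ModuleCat.{u} A)).obj N) (j + 1)).symm
  rw [HomologicalComplex.homologyFunctor_obj, ← HomologicalComplex.exactAt_iff_isZero_homology,
    HomologicalComplex.exactAt_iff' _ (j + 1 + 1) (j + 1) j (by simp) (by simp),
    ShortComplex.moduleCat_exact_iff_range_eq_ker] at hz
  have e : ∀ j, ((Functor.mapHomologicalComplex ((MonoidalCategory.tensoringLeft (ModuleCat.{u} A)).obj N)
      (ComplexShape.down ℕ)).obj (freeComplex n d hd)).d (j + 1) j =
      ModuleCat.ofHom ((d j).lTensor N) := by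
    intro j
    rw [Functor.mapHomologicalComplex_obj_d, freeComplex_d]
    rfl
  have e' := congrArg ModuleCat.Hom.hom (e j)
  have e'' := congrArg ModuleCat.Hom.hom (e (j + 1))
  rw [LinearMap.exact_iff]
  refine Eq.trans (congrArg LinearMap.ker e'.symm) (hz.symm.trans (congrArg LinearMap.range e''))

theorem exists_minimal_free_resolution [IsLocalRing A] [IsNoetherianRing A]
    (M : Type u) [AddCommGroup M] [Module A M] [Module.Finite A M] :
    ∃ (n : ℕ → ℕ) (ε : (Fin (n 0) → A) →ₗ[A] M)
      (d : ∀ j, (Fin (n (j + 1)) → A) →ₗ[A] (Fin (n j) → A)),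
      Function.Surjective ε ∧ LinearMap.ker ε = LinearMap.range (d 0) ∧
      (∀ j, LinearMap.ker (d j) = LinearMap.range (d (j + 1))) ∧
      ∀ j, ∀ z ∈ LinearMap.ker (d j), ∀ i, z i ∈ IsLocalRing.maximalIdeal A := by
  have step : ∀ s : Σ n, Submodule A (Fin n → A), ∃ (n : ℕ) (f : (Fin n → A) →ₗ[A] (Fin s.1 → A)),
      LinearMap.range f = s.2 ∧ ∀ g ∈ LinearMap.ker f, ∀ i, g i ∈ IsLocalRing.maximalIdeal A := by
    intro s
    obtain ⟨n, f, hf, hg⟩ := exists_minimal_free_cover (A := A) s.2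
    refine ⟨n, s.2.subtype ∘ₗ f, ?_, fun g hgk ↦ hg g (Subtype.ext hgk)⟩
    rw [LinearMap.range_comp, LinearMap.range_eq_top.2 hf, Submodule.map_top,
      Submodule.range_subtype]
  choose n f hf hker using step
  obtain ⟨n0, ε, hε, -⟩ := exists_minimal_free_cover (A := A) M
  let s : ℕ → Σ n, Submodule A (Fin n → A) :=
    Nat.rec ⟨n0, LinearMap.ker ε⟩ fun _ s ↦ ⟨n s, LinearMap.ker (f s)⟩
  exact ⟨fun j ↦ (s j).1, ε, fun j ↦ f (s j), hε, (hf (s 0)).symm, fun j ↦ (hf (s (j + 1))).symm,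
    fun j ↦ hker (s j)⟩

end Resolution

section Persistence

open IsLocalRing

variable {A : Type u} [CommRing A]

theorem hasFiniteProjDim_of_ker_eq_bot [IsLocalRing A] (M : ModuleCat.{u} A) (n : ℕ → ℕ)
    (ε : (Fin (n 0) → A) →ₗ[A] M) (d : ∀ j, (Fin (n (j + 1)) → A) →ₗ[A] (Fin (n j) → A))
    (hε : Function.Surjective ε) (h0 : LinearMap.ker ε = LinearMap.range (d 0))
    (hd : ∀ j, LinearMap.ker (d j) = LinearMap.range (d (j + 1)))
    (hmin : ∀ j, ∀ z ∈ LinearMap.ker (d j), ∀ i, z i ∈ maximalIdeal A) {k : ℕ}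
    (hk : LinearMap.ker (d k) = ⊥) : HasFiniteProjDim A M := by
  have hker : ∀ j, k ≤ j → LinearMap.ker (d j) = ⊥ := by
    intro j hj
    induction j, hj using Nat.le_induction with
    | base => exact hk
    | succ j hj ih =>
      have htop : LinearMap.ker (d (j + 1)) = ⊤ := by
        rw [LinearMap.ker_eq_top, ← LinearMap.range_eq_bot, ← hd j, ih]
      rw [htop, Submodule.eq_bot_iff]
      intro v _
      ext i
      have := hmin (j + 1) (fun _ ↦ 1) (htop ▸ Submodule.mem_top) i
      exact absurd this ((Ideal.ne_top_iff_one _).1 (maximalIdeal.isMaximal A).ne_top)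
  refine ⟨k + 1, freeResolution M n ε d hε h0 hd, fun j hj ↦ ?_⟩
  obtain ⟨i, rfl⟩ : ∃ i, j = (k + i) + 1 + 1 := ⟨j - k - 2, by omega⟩
  have hsub : Subsingleton (Fin (n (k + i + 1 + 1)) → A) := by
    refine subsingleton_of_forall_eq 0 fun v ↦ ?_
    have h1 : LinearMap.range (d (k + i + 1)) = ⊥ := by rw [← hd, hker _ (by omega)]
    have h2 : v ∈ LinearMap.ker (d (k + i + 1)) := by
      rw [LinearMap.range_eq_bot.1 h1, LinearMap.ker_zero]; trivial
    rwa [hker _ (by omega)] at h2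
  exact @ModuleCat.isZero_of_subsingleton _ _ (ModuleCat.of A (Fin (n (k + i + 1 + 1)) → A)) hsub

/-- A noetherian local ring whose maximal ideal is `(x, y, t)` with `t` regular and such that,
modulo `t`, the maximal ideal is the direct sum of `(x)` and `(y)`, is Tor-persistent. -/
theorem torPersistent_of_decomposable_modulo_regular [IsLocalRing A] [IsNoetherianRing A] {x y t : A}
    (hm : maximalIdeal A = Ideal.span {x, y, t}) (hxy : x * y = 0)
    (ht : ∀ a, t * a = 0 → a = 0) (hb : ∀ a b c, x * a + y * b = t * c → ∃ d, x * a = t * d)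
    (hx : x ∉ maximalIdeal A ^ 2 ⊔ Ideal.span {t})
    (hy : y ∉ maximalIdeal A ^ 2 ⊔ Ideal.span {t}) :
    TorPersistent A := by
  rintro M hM ⟨N, hN⟩
  obtain ⟨n, ε, d, hε, h0, hd, hmin⟩ := exists_minimal_free_resolution (A := A) M
  by_cases hne : LinearMap.ker (d 1) = ⊥
  · exact hasFiniteProjDim_of_ker_eq_bot M n ε d hε h0 hd hmin hne
  exfalso
  have htm : t ∈ maximalIdeal A := by rw [hm]; exact Ideal.subset_span (by simp)
  have hT0 : ∀ j, N ≤ j → Function.Injective ((LinearMap.ker (d j)).subtype.lTensor M) :=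
    fun j hj ↦ lTensor_subtype_ker_injective_of_exact (d j) (d (j + 1)) (d (j + 2)) (hd j)
      (hd (j + 1)) (lTensor_exact_of_subsingleton_tor M M n ε d hε h0 hd (j + 1)
        (hN (j + 1 + 1) (by omega)))
  have hTε : ∀ j, N ≤ j →
      Function.Injective ((LinearMap.ker (d j)).subtype.lTensor (LinearMap.ker ε)) :=
    fun j hj ↦ lTensor_subtype_ker_injective_of_lTensor (d j) (d (j + 1)) (hd j) ε hε
      (hT0 (j + 1) (by omega))
  have shift : ∀ {E F G : Type u} [AddCommGroup E] [AddCommGroup F] [AddCommGroup G] [Module A E]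
      [Module A F] [Module A G] [Module.Flat A G] (c : F →ₗ[A] E) (e : G →ₗ[A] F),
      LinearMap.ker c = LinearMap.range e →
      (∀ j, N ≤ j → Function.Injective ((LinearMap.ker (d j)).subtype.lTensor (LinearMap.ker c))) →
      ∀ j, N ≤ j →
        Function.Injective ((LinearMap.ker (d j)).subtype.lTensor (LinearMap.ker e)) := by
    intro E F G _ _ _ _ _ _ _ c e hce h j hj
    obtain ⟨e', he, hsurj, -⟩ := exists_lift_ker_of_ker_eq_range c e hce
    have hker : LinearMap.ker e' = LinearMap.ker e := by
      rw [← he, LinearMap.ker_comp, Submodule.ker_subtype]; rfl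
    rw [← hker]
    exact lTensor_subtype_ker_injective_of_lTensor (d j) (d (j + 1)) (hd j) e' hsurj
      (h (j + 1) (by omega))
  have hT := shift (d 0) (d 1) (hd 0) (shift ε (d 0) h0 hTε)
  have contra : ∀ x y : A, x * y = 0 → x ∉ maximalIdeal A ^ 2 ⊔ Ideal.span {t} →
      y ∉ maximalIdeal A ^ 2 ⊔ Ideal.span {t} →
      ∀ z ∈ LinearMap.ker (d 1), z ∉ maximalIdeal A • LinearMap.ker (d 1) →
      ∀ a p, z = x • a + t • p → False := by
    rintro x y hxy hx hy z hz hzm a p rfl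
    have alt : ∀ i, ∃ z ∈ LinearMap.ker (d (2 * i + 2)),
        z ∉ maximalIdeal A • LinearMap.ker (d (2 * i + 2)) ∧ ∃ a p, z = y • a + t • p := by
      intro i
      induction i with
      | zero =>
        exact exists_mem_ker_succ hxy ht hy (d 1) (d 2) (hd 1) (hmin 2) ⟨_, hz, hzm, a, p, rfl⟩
      | succ i ih =>
        exact exists_mem_ker_succ hxy ht hy (d (2 * i + 3)) (d (2 * i + 4)) (hd _) (hmin _)
          (exists_mem_ker_succ (mul_comm x y ▸ hxy) ht hx (d (2 * i + 2)) (d (2 * i + 3)) (hd _)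
            (hmin _) ih)
    have hyz : y • (x • a + t • p) = t • y • p := by
      rw [smul_add, smul_smul, mul_comm y x, hxy, zero_smul, zero_add, smul_comm]
    have hyp : y • p ∈ LinearMap.ker (d 1) := by
      have := Submodule.smul_mem _ y hz
      rw [hyz, LinearMap.mem_ker, map_smul] at this
      ext i
      exact ht _ (congrFun this i)
    refine false_of_lTensor_injective (d (2 * N + 1)) (d (2 * N + 2)) (hd _) htm (y := y)
      (L := LinearMap.ker (d 1)) (fun v hv ↦ ?_) (hT _ (by omega)) (hT _ (by omega))
      (v := ⟨_, hz⟩) (v' := ⟨_, hyp⟩) (fun h ↦ hzm ((Submodule.mem_smul_top_iff _ _ _).1 h))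
      (Subtype.ext hyz) (alt N)
    ext i
    exact ht _ (congrFun (congrArg Subtype.val hv) i)
  obtain ⟨z, hz, hzm, ⟨a, p, h⟩ | ⟨a, p, h⟩⟩ :=
    exists_mem_ker_notMem_smul hm hxy ht hb (d 0) (d 1) (hd 0) (hmin 0) (hmin 1) hne
  · exact contra x y hxy hx hy z hz hzm a p h
  · exact contra y x (mul_comm x y ▸ hxy) hy hx z hz hzm a p h

end Persistence

section RegularModulo

variable {R : Type*} [CommRing R]

/-- The element `a` is a nonzerodivisor modulo the ideal `J`. -/
def RegularModulo (J : Ideal R) (a : R) : Prop :=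
  ∀ f, a * f ∈ J → f ∈ J

theorem RegularModulo.mul {J : Ideal R} {a b : R} (ha : RegularModulo J a)
    (hb : RegularModulo J b) : RegularModulo J (a * b) :=
  fun f hf ↦ hb f (ha _ (by rwa [← mul_assoc]))

theorem RegularModulo.of_isUnit (J : Ideal R) {a : R} (ha : IsUnit a) : RegularModulo J a :=
  fun _ hf ↦ (Ideal.unit_mul_mem_iff_mem J ha).1 hf

theorem RegularModulo.add_of_sq_mem {J : Ideal R} {a b : R} (ha : RegularModulo J a)
    (hb : b ^ 4 ∈ J) : RegularModulo J (a + b ^ 2) := by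
  intro f hf
  refine ha.mul ha f ?_
  have h : a * a * f = (a - b ^ 2) * ((a + b ^ 2) * f) + f * b ^ 4 := by ring
  rw [h]
  exact J.add_mem (J.mul_mem_left _ hf) (J.mul_mem_left _ hb)

theorem RegularModulo.of_sub_mem {J : Ideal R} {a b : R} (ha : RegularModulo J a)
    (hab : b - a ∈ J) : RegularModulo J b := by
  intro f hf
  refine ha f ?_
  have h : a * f = b * f - f * (b - a) := by ring
  rw [h]
  exact J.sub_mem hf (J.mul_mem_left _ hab)

/-- If `a, b` is a regular sequence modulo `J`, then `a` is regular modulo `J + (b)`. -/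
theorem RegularModulo.sup_span_singleton {J : Ideal R} {a b : R} (ha : RegularModulo J a)
    (hb : RegularModulo (J ⊔ Ideal.span {a}) b) : RegularModulo (J ⊔ Ideal.span {b}) a := by
  intro f hf
  obtain ⟨j, hj, r, hr, hjr⟩ := Submodule.mem_sup.1 hf
  obtain ⟨g, rfl⟩ := Ideal.mem_span_singleton'.1 hr
  have hg : g ∈ J ⊔ Ideal.span {a} := by
    refine hb g (Submodule.mem_sup.2 ⟨-j, J.neg_mem hj, a * f, ?_, ?_⟩)
    · exact Ideal.mul_mem_right _ _ (Ideal.mem_span_singleton_self a)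
    · linear_combination -hjr
  obtain ⟨j', hj', r', hr', hg'⟩ := Submodule.mem_sup.1 hg
  obtain ⟨g', rfl⟩ := Ideal.mem_span_singleton'.1 hr'
  refine Submodule.mem_sup.2 ⟨f - g' * b, ha _ ?_, g' * b, ?_, by ring⟩
  · have h : a * (f - g' * b) = j + b * j' := by linear_combination -hjr - b * hg'
    rw [h]
    exact J.add_mem hj (J.mul_mem_left _ hj')
  · exact Ideal.mul_mem_left _ _ (Ideal.mem_span_singleton_self b)

end RegularModulo

namespace MvPowerSeries

variable {σ k : Type*} [Field k]

/-- Membership in an ideal generated by finitely many monomials is determined by the support. -/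
theorem mem_span_monomial_iff (S : Finset (σ →₀ ℕ)) (f : MvPowerSeries σ k) :
    f ∈ Ideal.span ((fun s ↦ monomial s (1 : k)) '' (S : Set (σ →₀ ℕ))) ↔
      ∀ n, (∀ s ∈ S, ¬ s ≤ n) → coeff n f = 0 := by
  classical
  constructor
  · intro hf
    induction hf using Submodule.span_induction with
    | mem g hg =>
      obtain ⟨s, hs, rfl⟩ := hg
      exact fun n hn ↦ coeff_monomial_ne (fun h ↦ hn s hs h.ge) _
    | zero => simp
    | add g h _ _ hg hh => exact fun n hn ↦ by rw [map_add, hg n hn, hh n hn, add_zero]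
    | smul a g _ hg =>
      intro n hn
      rw [smul_eq_mul, coeff_mul]
      refine Finset.sum_eq_zero fun p hp ↦ ?_
      have hp' : p.2 ≤ n := Finset.HasAntidiagonal.mem_antidiagonal.1 hp ▸ le_add_self
      rw [hg p.2 fun s hs h ↦ hn s hs (h.trans hp'), mul_zero]
  · induction S using Finset.induction_on generalizing f with
    | empty =>
      intro hf
      have : f = 0 := by ext n; exact hf n (by simp)
      simp [this]
    | insert s S _ ih =>
      intro hf
      let g : MvPowerSeries σ k := fun n ↦ coeff (s + n) f
      have hg : ∀ n, coeff n g = coeff (s + n) f := fun n ↦ rfl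
      have hfg : f = g * monomial s 1 + (f - monomial s 1 * g) := by ring
      rw [hfg, Finset.coe_insert, Set.image_insert_eq]
      refine Ideal.add_mem _ (Ideal.mul_mem_left _ _ (Ideal.subset_span (by simp))) ?_
      refine Ideal.span_mono (Set.subset_insert _ _) (ih _ fun n hn ↦ ?_)
      rw [map_sub, coeff_monomial_mul]
      split_ifs with h
      · rw [hg, add_tsub_cancel_of_le h, one_mul, sub_self]
      · rw [sub_zero]
        refine hf n fun t ht ↦ ?_
        rcases Finset.mem_insert.1 ht with rfl | ht
        exacts [h, hn t ht]

theorem regularModulo_X {S : Finset (σ →₀ ℕ)} {i : σ} (hi : ∀ s ∈ S, s i = 0) :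
    RegularModulo (Ideal.span ((fun s ↦ monomial s (1 : k)) '' (S : Set (σ →₀ ℕ)))) (X i) := by
  intro f hf
  rw [mem_span_monomial_iff] at hf ⊢
  intro n hn
  have h := hf (Finsupp.single i 1 + n) fun s hs hle ↦ hn s hs fun j ↦ ?_
  · rwa [X_def, coeff_add_monomial_mul, one_mul] at h
  · by_cases hj : j = i
    · rw [hj, hi s hs]; exact Nat.zero_le _
    · have := hle j
      rwa [Finsupp.add_apply, Finsupp.single_eq_of_ne hj, zero_add] at this

theorem constantCoeff_eq_zero_of_mem_maximalIdeal {f : MvPowerSeries σ k}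
    (hf : f ∈ IsLocalRing.maximalIdeal (MvPowerSeries σ k)) : constantCoeff f = 0 := by
  by_contra h
  exact hf (isUnit_iff_constantCoeff.2 (isUnit_iff_ne_zero.2 h))

theorem maximalIdeal_eq_span_X [Finite σ] :
    IsLocalRing.maximalIdeal (MvPowerSeries σ k) = Ideal.span (Set.range X) := by
  classical
  cases nonempty_fintype σ
  apply le_antisymm
  · intro f hf
    have hS : Set.range (X : σ → MvPowerSeries σ k) = (fun s ↦ monomial s (1 : k)) ''
        ((Finset.univ.image fun i : σ ↦ Finsupp.single i 1 : Finset (σ →₀ ℕ)) :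
          Set (σ →₀ ℕ)) := by
      ext g; simp [X_def]
    rw [hS, mem_span_monomial_iff]
    intro n hn
    have : n = 0 := by
      ext i
      by_contra h
      exact hn (Finsupp.single i 1) (by simp)
        (Finsupp.single_le_iff.2 (Nat.one_le_iff_ne_zero.2 h))
    rw [this, coeff_zero_eq_constantCoeff_apply, constantCoeff_eq_zero_of_mem_maximalIdeal hf]
  · rw [Ideal.span_le]
    rintro _ ⟨i, rfl⟩ hu
    have := isUnit_iff_constantCoeff.1 hu
    simp at this

theorem coeff_single_one_mul (i : σ) (f g : MvPowerSeries σ k) :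
    coeff (Finsupp.single i 1) (f * g) =
      coeff (Finsupp.single i 1) f * constantCoeff g +
        constantCoeff f * coeff (Finsupp.single i 1) g := by
  classical
  rw [coeff_mul, Finsupp.antidiagonal_single]
  simp [Finset.Nat.antidiagonal_succ]
  ring


/-- The power series without constant term and without term `X i`. -/
def idealOfLinearCoeffEqZero (i : σ) : Ideal (MvPowerSeries σ k) where
  carrier := {f | constantCoeff f = 0 ∧ coeff (Finsupp.single i 1) f = 0}
  add_mem' hf hg := ⟨by rw [map_add, hf.1, hg.1, add_zero], by rw [map_add, hf.2, hg.2, add_zero]⟩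
  zero_mem' := ⟨map_zero _, map_zero _⟩
  smul_mem' a f hf :=
    ⟨by rw [smul_eq_mul, map_mul, hf.1, mul_zero],
      by rw [smul_eq_mul, coeff_single_one_mul, hf.1, hf.2, mul_zero, mul_zero, add_zero]⟩

theorem mem_idealOfLinearCoeffEqZero {i : σ} {f : MvPowerSeries σ k} :
    f ∈ idealOfLinearCoeffEqZero i ↔ constantCoeff f = 0 ∧ coeff (Finsupp.single i 1) f = 0 :=
  Iff.rfl

theorem maximalIdeal_sq_le_idealOfLinearCoeffEqZero (i : σ) :
    IsLocalRing.maximalIdeal (MvPowerSeries σ k) ^ 2 ≤ idealOfLinearCoeffEqZero i := by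
  rw [sq, Ideal.mul_le]
  intro f hf g hg
  have hf' := constantCoeff_eq_zero_of_mem_maximalIdeal hf
  have hg' := constantCoeff_eq_zero_of_mem_maximalIdeal hg
  exact ⟨by rw [map_mul, hf', zero_mul],
    by rw [coeff_single_one_mul, hf', hg', mul_zero, zero_mul, add_zero]⟩

theorem X_notMem_idealOfLinearCoeffEqZero (i : σ) :
    (X i : MvPowerSeries σ k) ∉ idealOfLinearCoeffEqZero i :=
  fun h ↦ one_ne_zero ((coeff_index_single_self_X i).symm.trans h.2)

end MvPowerSeries

theorem IsLocalRing.map_mk_maximalIdeal {R : Type*} [CommRing R] [IsLocalRing R] (I : Ideal R)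
    [IsLocalRing (R ⧸ I)] :
    (maximalIdeal R).map (Ideal.Quotient.mk I) = maximalIdeal (R ⧸ I) := by
  have := IsLocalHom.of_surjective (Ideal.Quotient.mk I) Ideal.Quotient.mk_surjective
  refine le_antisymm (map_maximalIdeal_le _) fun a ha ↦ ?_
  obtain ⟨f, rfl⟩ := Ideal.Quotient.mk_surjective a
  exact Ideal.mem_map_of_mem _ fun hf ↦ ha (hf.map _)

section FiveGenerators

variable {R : Type*} [CommRing R] {x y u v w : R}

theorem regularModulo_span_of_monomial_part
    (hu : RegularModulo (Ideal.span {x ^ 4, y ^ 3, x * y}) u)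
    (hv : RegularModulo (Ideal.span {x ^ 4, y ^ 3, x * y} ⊔ Ideal.span {u}) v)
    (hw : RegularModulo (Ideal.span {x ^ 4, y ^ 3, x * y} ⊔ Ideal.span {u}) w)
    (hwv : RegularModulo (Ideal.span {x ^ 4, y ^ 3, x * y} ⊔ Ideal.span {u} ⊔ Ideal.span {w}) v)
    (hw' : IsUnit (1 + w)) :
    RegularModulo (Ideal.span {x ^ 4, y ^ 3, x * y, y ^ 2 + u ^ 3 + u * v + v,
      x ^ 2 + u * v ^ 2 + w + w ^ 2}) u := by
  have hI : Ideal.span {x ^ 4, y ^ 3, x * y, y ^ 2 + u ^ 3 + u * v + v,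
      x ^ 2 + u * v ^ 2 + w + w ^ 2} = Ideal.span {x ^ 4, y ^ 3, x * y} ⊔
        Ideal.span {y ^ 2 + u ^ 3 + u * v + v} ⊔ Ideal.span {x ^ 2 + u * v ^ 2 + w + w ^ 2} := by
    simp only [Ideal.span_insert, sup_assoc]
  rw [hI]
  clear hI
  have hx4 : x ^ 4 ∈ Ideal.span {x ^ 4, y ^ 3, x * y} := Ideal.subset_span (by simp)
  have hy3 : y ^ 3 ∈ Ideal.span {x ^ 4, y ^ 3, x * y} := Ideal.subset_span (by simp)
  have hy4 : y ^ 4 ∈ Ideal.span {x ^ 4, y ^ 3, x * y} := by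
    have h : y ^ 4 = y * y ^ 3 := by ring
    rw [h]
    exact Ideal.mul_mem_left _ _ hy3
  generalize Ideal.span {x ^ 4, y ^ 3, x * y} = J at *
  have hvu := hv.add_of_sq_mem (Ideal.mem_sup_left hy4)
  have hg4 : y ^ 2 + u ^ 3 + u * v + v - (v + y ^ 2) ∈ J ⊔ Ideal.span {u} :=
    Ideal.mem_sup_right (Ideal.mem_span_singleton'.2 ⟨u ^ 2 + v, by ring⟩)
  have hL : J ⊔ Ideal.span {u} ⊔ Ideal.span {v + y ^ 2} =
      J ⊔ Ideal.span {y ^ 2 + u ^ 3 + u * v + v} ⊔ Ideal.span {u} := by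
    rw [sup_assoc, sup_assoc, ← Ideal.span_insert, ← Ideal.span_insert]
    congr 1
    ext z
    simp only [Ideal.mem_span_pair]
    constructor
    · rintro ⟨a, b, rfl⟩
      exact ⟨b, a - b * (u ^ 2 + v), by ring⟩
    · rintro ⟨b, a, rfl⟩
      exact ⟨a + b * (u ^ 2 + v), b, by ring⟩
  refine (hu.sup_span_singleton (hvu.of_sub_mem hg4)).sup_span_singleton ?_
  rw [← hL]
  have hwL := hw.sup_span_singleton
    (hwv.add_of_sq_mem (Ideal.mem_sup_left (Ideal.mem_sup_left hy4)))
  refine ((hwL.mul (.of_isUnit _ hw')).add_of_sq_mem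
    (Ideal.mem_sup_left (Ideal.mem_sup_left hx4))).of_sub_mem ?_
  exact Ideal.mem_sup_left (Ideal.mem_sup_right (Ideal.mem_span_singleton'.2 ⟨v ^ 2, by ring⟩))

theorem mul_mem_of_add_mem_sup_span {I : Ideal R}
    (hI : I = Ideal.span {x ^ 4, y ^ 3, x * y, y ^ 2 + u ^ 3 + u * v + v,
      x ^ 2 + u * v ^ 2 + w + w ^ 2})
    (hx : RegularModulo (Ideal.span {y, u, v}) x)
    (hw : RegularModulo (Ideal.span {y, u, v} ⊔ Ideal.span {x}) w)
    (hw' : IsUnit (1 + w)) {a b : R} (hab : x * a + y * b ∈ I ⊔ Ideal.span {u}) :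
    x * a ∈ I ⊔ Ideal.span {u} := by
  set K := I ⊔ Ideal.span {u} with hK
  have hxy : x * y ∈ K := Ideal.mem_sup_left (hI ▸ Ideal.subset_span (by simp))
  have hx4 : x ^ 4 ∈ K := Ideal.mem_sup_left (hI ▸ Ideal.subset_span (by simp))
  have hu : u ∈ K := Ideal.mem_sup_right (Ideal.mem_span_singleton_self u)
  have hxv : x * v ∈ K := by
    have h : y ^ 2 + u ^ 3 + u * v + v ∈ K :=
      Ideal.mem_sup_left (hI ▸ Ideal.subset_span (by simp))
    have e : x * v = x * (y ^ 2 + u ^ 3 + u * v + v) - (y * (x * y) + x * (u ^ 2 + v) * u) := by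
      ring
    rw [e]
    exact K.sub_mem (K.mul_mem_left _ h)
      (K.add_mem (K.mul_mem_left _ hxy) (K.mul_mem_left _ hu))
  have hg : x ^ 2 + w * (1 + w) ∈ K := by
    have h : x ^ 2 + u * v ^ 2 + w + w ^ 2 ∈ K :=
      Ideal.mem_sup_left (hI ▸ Ideal.subset_span (by simp))
    have e : x ^ 2 + w * (1 + w) = x ^ 2 + u * v ^ 2 + w + w ^ 2 - v ^ 2 * u := by ring
    rw [e]
    exact K.sub_mem h (K.mul_mem_left _ hu)
  have hyL : y ∈ Ideal.span {y, u, v} := Ideal.subset_span (by simp)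
  have huL : u ∈ Ideal.span {y, u, v} := Ideal.subset_span (by simp)
  have hvL : v ∈ Ideal.span {y, u, v} := Ideal.subset_span (by simp)
  have hxL : ∀ l ∈ Ideal.span {y, u, v}, x * l ∈ K := by
    intro l hl
    obtain ⟨c, d, e, rfl⟩ := Submodule.mem_span_triple.1 hl
    have h : x * (c • y + d • u + e • v) = c * (x * y) + d * x * u + e * (x * v) := by
      simp only [smul_eq_mul]
      ring
    rw [h]
    exact K.add_mem (K.add_mem (K.mul_mem_left _ hxy) (K.mul_mem_left _ hu)) (K.mul_mem_left _ hxv)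
  generalize Ideal.span {y, u, v} = L at *
  have hKL : K ≤ L ⊔ Ideal.span {x ^ 4, x ^ 2 + w * (1 + w)} := by
    rw [hK, hI, sup_le_iff, Ideal.span_le, Ideal.span_singleton_le_iff_mem]
    refine ⟨?_, Ideal.mem_sup_left huL⟩
    rintro _ (rfl | rfl | rfl | rfl | rfl)
    · exact Ideal.mem_sup_right (Ideal.subset_span (by simp))
    · exact Ideal.mem_sup_left (Ideal.pow_mem_of_mem _ hyL _ (by decide))
    · exact Ideal.mem_sup_left (L.mul_mem_left _ hyL)
    · refine Ideal.mem_sup_left ?_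
      have e : y ^ 2 + u ^ 3 + u * v + v = y * y + u ^ 2 * u + (u + 1) * v := by ring
      rw [e]
      exact L.add_mem (L.add_mem (L.mul_mem_left _ hyL) (L.mul_mem_left _ huL))
        (L.mul_mem_left _ hvL)
    · have e : x ^ 2 + u * v ^ 2 + w + w ^ 2 = u * v * v + (x ^ 2 + w * (1 + w)) := by ring
      rw [e]
      exact add_mem (Ideal.mem_sup_left (L.mul_mem_left _ hvL))
        (Ideal.mem_sup_right (Ideal.subset_span (by simp)))
  obtain ⟨l, hl, r, hr, hlr⟩ := Submodule.mem_sup.1 (hKL hab)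
  obtain ⟨p, q, rfl⟩ := Ideal.mem_span_pair.1 hr
  have hq : q ∈ L ⊔ Ideal.span {x} := by
    refine hw.mul (.of_isUnit _ hw') q ?_
    refine Submodule.mem_sup.2 ⟨y * b - l, L.sub_mem (L.mul_mem_right _ hyL) hl,
      (a - x ^ 3 * p - x * q) * x, Ideal.mul_mem_left _ _ (Ideal.mem_span_singleton_self x), ?_⟩
    linear_combination -hlr
  obtain ⟨m, hm, r, hr', hmr⟩ := Submodule.mem_sup.1 hq
  obtain ⟨q', rfl⟩ := Ideal.mem_span_singleton'.1 hr'
  have ha : a - x ^ 3 * p - (x ^ 2 + w * (1 + w)) * q' ∈ L := by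
    refine hx _ ?_
    have e : x * (a - x ^ 3 * p - (x ^ 2 + w * (1 + w)) * q') =
        l + (x ^ 2 + w * (1 + w)) * m - y * b := by
      linear_combination -hlr - (x ^ 2 + w * (1 + w)) * hmr
    rw [e]
    exact L.sub_mem (L.add_mem hl (L.mul_mem_left _ hm)) (L.mul_mem_right _ hyL)
  have e : x * a = x * (a - x ^ 3 * p - (x ^ 2 + w * (1 + w)) * q') +
      (p * x ^ 4 + x * q' * (x ^ 2 + w * (1 + w))) := by ring
  rw [e]
  exact K.add_mem (hxL _ ha) (K.add_mem (K.mul_mem_left _ hx4) (K.mul_mem_left _ hg))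

theorem span_eq_span_of_isUnit_one_add (hu : IsUnit (1 + u)) (hw : IsUnit (1 + w))
    (hv : y ^ 2 + u ^ 3 + u * v + v = 0) (hw' : x ^ 2 + u * v ^ 2 + w + w ^ 2 = 0) :
    Ideal.span {x, y, u, v, w} = Ideal.span {x, y, u} := by
  have hx : x ∈ Ideal.span {x, y, u} := Ideal.subset_span (by simp)
  have hy : y ∈ Ideal.span {x, y, u} := Ideal.subset_span (by simp)
  have hu' : u ∈ Ideal.span {x, y, u} := Ideal.subset_span (by simp)
  refine le_antisymm ?_ (Ideal.span_mono fun z hz ↦ by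
    rcases hz with rfl | rfl | rfl <;> simp)
  simp only [Ideal.span_le, Set.insert_subset_iff, Set.singleton_subset_iff, SetLike.mem_coe]
  refine ⟨hx, hy, hu', ?_, ?_⟩
  · refine (Ideal.unit_mul_mem_iff_mem _ hu).1 ?_
    have h : (1 + u) * v = -y * y - u ^ 2 * u := by linear_combination hv
    rw [h]
    exact Ideal.sub_mem _ (Ideal.mul_mem_left _ _ hy) (Ideal.mul_mem_left _ _ hu')
  · refine (Ideal.unit_mul_mem_iff_mem _ hw).1 ?_
    have h : (1 + w) * w = -x * x - v ^ 2 * u := by linear_combination hw'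
    rw [h]
    exact Ideal.sub_mem _ (Ideal.mul_mem_left _ _ hx) (Ideal.mul_mem_left _ _ hu')

end FiveGenerators

open MvPowerSeries in
/-- Let `k` be a field.  The local ring
`A = k[[X,Y,U,V,W]]/(X⁴, Y³, XY, Y² + U³ + UV + V, X² + UV² + W + W²)`
is Tor-persistent.  Here `X = X 0`, `Y = X 1`, `U = X 2`, `V = X 3`, `W = X 4` in
`MvPowerSeries (Fin 5) k`. -/
theorem torPersistent_concrete_example (k : Type u) [Field k] :
    TorPersistent (MvPowerSeries (Fin 5) k ⧸
      Ideal.span {(X 0 ^ 4 : MvPowerSeries (Fin 5) k),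
        (X 1 ^ 3 : MvPowerSeries (Fin 5) k),
        (X 0 * X 1 : MvPowerSeries (Fin 5) k),
        (X 1 ^ 2 + X 2 ^ 3 + X 2 * X 3 + X 3 : MvPowerSeries (Fin 5) k),
        (X 0 ^ 2 + X 2 * X 3 ^ 2 + X 4 + X 4 ^ 2 : MvPowerSeries (Fin 5) k)}) := by
  set I : Ideal (MvPowerSeries (Fin 5) k) := Ideal.span _ with hI
  have hunit : ∀ i : Fin 5, IsUnit (1 + X i : MvPowerSeries (Fin 5) k) :=
    fun i ↦ isUnit_iff_constantCoeff.2 (by simp)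
  have hcoeff : ∀ i : Fin 5, i = 0 ∨ i = 1 → I ≤ idealOfLinearCoeffEqZero i := by
    intro i hi
    rw [hI, Ideal.span_le]
    rintro _ (rfl | rfl | rfl | rfl | rfl) <;> rcases hi with rfl | rfl <;>
      refine mem_idealOfLinearCoeffEqZero.2 ⟨?_, ?_⟩ <;>
      simp [pow_succ, coeff_single_one_mul, coeff_index_single_X]
  have hm : IsLocalRing.maximalIdeal (MvPowerSeries (Fin 5) k) =
      Ideal.span {X 0, X 1, X 2, X 3, X 4} := by
    rw [maximalIdeal_eq_span_X]
    congr 1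
    ext f
    simp [Fin.exists_fin_succ, eq_comm]
  have : Nontrivial (MvPowerSeries (Fin 5) k ⧸ I) := Ideal.Quotient.nontrivial_iff.2 fun h ↦
    X_notMem_idealOfLinearCoeffEqZero 0 (hcoeff 0 (.inl rfl) (h ▸ Submodule.mem_top))
  have : IsLocalRing (MvPowerSeries (Fin 5) k ⧸ I) :=
    IsLocalRing.of_surjective' (Ideal.Quotient.mk I) Ideal.Quotient.mk_surjective
  have hnot : ∀ i : Fin 5, i = 0 ∨ i = 1 → Ideal.Quotient.mk I (X i) ∉
      IsLocalRing.maximalIdeal (MvPowerSeries (Fin 5) k ⧸ I) ^ 2 ⊔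
        Ideal.span {Ideal.Quotient.mk I (X 2)} := by
    intro i hi h
    rw [← IsLocalRing.map_mk_maximalIdeal, ← Ideal.map_pow, ← Set.image_singleton,
      ← Ideal.map_span, ← Ideal.map_sup, Ideal.mem_quotient_iff_mem_sup] at h
    refine X_notMem_idealOfLinearCoeffEqZero i
      (sup_le (sup_le (maximalIdeal_sq_le_idealOfLinearCoeffEqZero i) ?_) (hcoeff i hi) h)
    rw [Ideal.span_singleton_le_iff_mem, mem_idealOfLinearCoeffEqZero]
    rcases hi with rfl | rfl <;> simp [coeff_index_single_X]
  refine torPersistent_of_decomposable_modulo_regular (x := Ideal.Quotient.mk I (X 0))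
    (y := Ideal.Quotient.mk I (X 1)) (t := Ideal.Quotient.mk I (X 2)) ?_ ?_ ?_ ?_
    (hnot 0 (.inl rfl)) (hnot 1 (.inr rfl))
  · rw [← IsLocalRing.map_mk_maximalIdeal, hm, Ideal.map_span]
    simp only [Set.image_insert_eq, Set.image_singleton]
    have hu : IsUnit (Ideal.Quotient.mk I (1 + X 2)) := (hunit 2).map _
    have hw : IsUnit (Ideal.Quotient.mk I (1 + X 4)) := (hunit 4).map _
    have hg₁ : Ideal.Quotient.mk I (X 1 ^ 2 + X 2 ^ 3 + X 2 * X 3 + X 3) = 0 :=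
      Ideal.Quotient.eq_zero_iff_mem.2 (Ideal.subset_span (by simp))
    have hg₂ : Ideal.Quotient.mk I (X 0 ^ 2 + X 2 * X 3 ^ 2 + X 4 + X 4 ^ 2) = 0 :=
      Ideal.Quotient.eq_zero_iff_mem.2 (Ideal.subset_span (by simp))
    simp only [map_add, map_mul, map_pow, map_one] at hu hw hg₁ hg₂
    exact span_eq_span_of_isUnit_one_add hu hw hg₁ hg₂
  · rw [← map_mul]
    exact Ideal.Quotient.eq_zero_iff_mem.2 (Ideal.subset_span (by simp))
  · intro a ha
    obtain ⟨f, rfl⟩ := Ideal.Quotient.mk_surjective a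
    rw [← map_mul, Ideal.Quotient.eq_zero_iff_mem] at ha
    rw [Ideal.Quotient.eq_zero_iff_mem]
    refine regularModulo_span_of_monomial_part ?_ ?_ ?_ ?_ (hunit 4) f ha
    · have h := regularModulo_X (k := k)
        (S := {Finsupp.single 0 4, Finsupp.single 1 3, Finsupp.single 0 1 + Finsupp.single 1 1})
        (i := (2 : Fin 5)) (by simp)
      simpa [Set.image_insert_eq, Ideal.span_insert, sup_assoc, X_def, monomial_pow,
        monomial_mul_monomial] using h
    · have h := regularModulo_X (k := k)
        (S := {Finsupp.single 0 4, Finsupp.single 1 3, Finsupp.single 0 1 + Finsupp.single 1 1,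
          Finsupp.single 2 1})
        (i := (3 : Fin 5)) (by simp)
      simpa [Set.image_insert_eq, Ideal.span_insert, sup_assoc, X_def, monomial_pow,
        monomial_mul_monomial] using h
    · have h := regularModulo_X (k := k)
        (S := {Finsupp.single 0 4, Finsupp.single 1 3, Finsupp.single 0 1 + Finsupp.single 1 1,
          Finsupp.single 2 1})
        (i := (4 : Fin 5)) (by simp)
      simpa [Set.image_insert_eq, Ideal.span_insert, sup_assoc, X_def, monomial_pow,
        monomial_mul_monomial] using h
    · have h := regularModulo_X (k := k)
        (S := {Finsupp.single 0 4, Finsupp.single 1 3, Finsupp.single 0 1 + Finsupp.single 1 1,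
          Finsupp.single 2 1, Finsupp.single 4 1})
        (i := (3 : Fin 5)) (by simp)
      simpa [Set.image_insert_eq, Ideal.span_insert, sup_assoc, X_def, monomial_pow,
        monomial_mul_monomial] using h
  · intro a b c h
    obtain ⟨a, rfl⟩ := Ideal.Quotient.mk_surjective a
    obtain ⟨b, rfl⟩ := Ideal.Quotient.mk_surjective b
    obtain ⟨c, rfl⟩ := Ideal.Quotient.mk_surjective c
    simp only [← map_mul, ← map_add] at h
    rw [Ideal.Quotient.mk_eq_mk_iff_sub_mem] at h
    have hab : X 0 * a + X 1 * b ∈ I ⊔ Ideal.span {X 2} :=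
      Submodule.mem_sup.2 ⟨_, h, _, Ideal.mul_mem_right c _ (Ideal.mem_span_singleton_self _),
        sub_add_cancel _ _⟩
    have hmem : X 0 * a ∈ I ⊔ Ideal.span {X 2} := by
      refine mul_mem_of_add_mem_sup_span hI ?_ ?_ (hunit 4) hab
      · have h := regularModulo_X (k := k)
          (S := {Finsupp.single 1 1, Finsupp.single 2 1, Finsupp.single 3 1})
          (i := (0 : Fin 5)) (by simp)
        simpa [Set.image_insert_eq, Ideal.span_insert, sup_assoc, X_def, monomial_pow,
          monomial_mul_monomial] using h
      · have h := regularModulo_X (k := k)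
          (S := {Finsupp.single 1 1, Finsupp.single 2 1, Finsupp.single 3 1, Finsupp.single 0 1})
          (i := (4 : Fin 5)) (by simp)
        simpa [Set.image_insert_eq, Ideal.span_insert, sup_assoc, X_def, monomial_pow,
          monomial_mul_monomial] using h
    obtain ⟨j, hj, r, hr, hjr⟩ := Submodule.mem_sup.1 hmem
    obtain ⟨d, rfl⟩ := Ideal.mem_span_singleton'.1 hr
    refine ⟨Ideal.Quotient.mk I d, ?_⟩
    rw [← map_mul, ← map_mul, Ideal.Quotient.mk_eq_mk_iff_sub_mem, ← hjr]
    rwa [mul_comm d, add_sub_cancel_right]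
end

section
/- Let (R, m, k) be a commutative noetherian local ring, let x ∈ m be a non zero-divisor on R, and let N be a finitely generated R/(x)-module such that Tor_i^{R/(x)}(N, N) = 0 for all sufficiently large i. Then Tor_i^R(N, N) = 0 for all sufficiently large i. -/
open CategoryTheory CategoryTheory.Limits

universe u

section Ext

open Abelian

variable {A : Type u} [CommRing A]
  {L M P : Type u} [AddCommGroup L] [Module A L] [AddCommGroup M] [Module A M]
  [AddCommGroup P] [Module A P] (W : Type u) [AddCommGroup W] [Module A W]
  {f : L →ₗ[A] P} {g : P →ₗ[A] M}

/-- The middle term of a short exact sequence has vanishing `Ext` if the outer terms do. -/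
lemma subsingleton_ext_of_shortExact (hf : Function.Injective f) (hg : Function.Surjective g)
    (hfg : Function.Exact f g) (i : ℕ)
    (h₁ : Subsingleton (Ext (ModuleCat.of A L) (ModuleCat.of A W) i))
    (h₃ : Subsingleton (Ext (ModuleCat.of A M) (ModuleCat.of A W) i)) :
    Subsingleton (Ext (ModuleCat.of A P) (ModuleCat.of A W) i) := by
  have h := ModuleCat.shortComplex_shortExact
    (ModuleCat.shortComplexOfCompEqZero f g hfg.linearMap_comp_eq_zero) hfg hf hg
  refine subsingleton_of_forall_eq 0 fun e ↦ ?_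
  obtain ⟨e', rfl⟩ := Ext.contravariant_sequence_exact₂ h (ModuleCat.of A W) e (h₁.elim _ _)
  rw [h₃.elim e' 0, Ext.comp_zero]

/-- Dimension shifting along a short exact sequence with projective middle term. -/
lemma subsingleton_ext_succ_iff_of_projective [Module.Projective A P]
    (hf : Function.Injective f) (hg : Function.Surjective g)
    (hfg : Function.Exact f g) (i : ℕ) :
    Subsingleton (Ext (ModuleCat.of A M) (ModuleCat.of A W) (i + 2)) ↔
      Subsingleton (Ext (ModuleCat.of A L) (ModuleCat.of A W) (i + 1)) := by
  have h := ModuleCat.shortComplex_shortExact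
    (ModuleCat.shortComplexOfCompEqZero f g hfg.linearMap_comp_eq_zero) hfg hf hg
  have hP := fun n ↦ Ext.subsingleton_of_projective (ModuleCat.of A P) (ModuleCat.of A W) n
  constructor <;> refine fun h' ↦ subsingleton_of_forall_eq 0 fun e ↦ ?_
  · obtain ⟨e', rfl⟩ := Ext.contravariant_sequence_exact₁ h (ModuleCat.of A W) e
      (add_comm 1 (i + 1)) (h'.elim _ _)
    rw [(hP i).elim e' 0, Ext.comp_zero]
  · obtain ⟨e', rfl⟩ := Ext.contravariant_sequence_exact₃ h (ModuleCat.of A W) e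
      ((hP (i + 1)).elim _ _) (add_comm 1 (i + 1))
    rw [h'.elim e' 0, Ext.comp_zero]

/-- `Ext¹` vanishes if and only if maps extend along the kernel of a projective presentation. -/
lemma subsingleton_ext_one_iff_of_projective [Module.Projective A P]
    (hf : Function.Injective f) (hg : Function.Surjective g)
    (hfg : Function.Exact f g) :
    Subsingleton (Ext (ModuleCat.of A M) (ModuleCat.of A W) 1) ↔
      Function.Surjective (f.lcomp A W) := by
  have h := ModuleCat.shortComplex_shortExact
    (ModuleCat.shortComplexOfCompEqZero f g hfg.linearMap_comp_eq_zero) hfg hf hg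
  have hP := Ext.subsingleton_of_projective (ModuleCat.of A P) (ModuleCat.of A W) 0
  constructor
  · intro h' φ
    obtain ⟨e', he'⟩ := Ext.contravariant_sequence_exact₁ h (ModuleCat.of A W)
      (Ext.mk₀ (ModuleCat.ofHom φ)) (add_zero 1) (h'.elim _ _)
    obtain ⟨ψ, rfl⟩ := Ext.mk₀_bijective _ _ |>.2 e'
    rw [Ext.mk₀_comp_mk₀] at he'
    have := (Ext.mk₀_bijective _ _).1 he'
    exact ⟨ψ.hom, congr(($this).hom)⟩
  · refine fun h' ↦ subsingleton_of_forall_eq 0 fun e ↦ ?_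
    obtain ⟨e', rfl⟩ := Ext.contravariant_sequence_exact₃ h (ModuleCat.of A W) e
      (hP.elim _ _) (add_zero 1)
    obtain ⟨φ, rfl⟩ := Ext.mk₀_bijective _ _ |>.2 e'
    obtain ⟨ψ, hψ⟩ := h' φ.hom
    have : φ = ModuleCat.ofHom f ≫ ModuleCat.ofHom ψ := by
      ext1; exact hψ.symm
    rw [this, ← Ext.mk₀_comp_mk₀]
    exact h.extClass_comp_assoc _

end Ext

section Character

open Abelian

variable {A : Type u} [CommRing A]

/-- Pontryagin duality reflects exactness. -/
lemma CharacterModule.exact_dual_iff {L M N : Type u} [AddCommGroup L] [Module A L]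
    [AddCommGroup M] [Module A M] [AddCommGroup N] [Module A N]
    {f : L →ₗ[A] M} {g : M →ₗ[A] N} (hgf : g ∘ₗ f = 0) :
    Function.Exact (dual g) (dual f) ↔ Function.Exact f g := by
  constructor
  · refine fun h b ↦ ⟨fun hb ↦ ?_, fun ⟨a, ha⟩ ↦ ha ▸ LinearMap.congr_fun hgf a⟩
    change b ∈ LinearMap.range f
    rw [← Submodule.Quotient.mk_eq_zero]
    refine eq_zero_of_character_apply fun c ↦ ?_
    obtain ⟨c', hc'⟩ := (h (dual (LinearMap.range f).mkQ c)).1 <| by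
      ext a
      have : (LinearMap.range f).mkQ (f a) = 0 := by simp
      exact congr(c $this).trans c.map_zero
    exact congr($hc' b).symm.trans (congr(c' $hb).trans c'.map_zero)
  · refine fun h c ↦ ⟨fun hc ↦ ?_, ?_⟩
    · have hinj : Function.Injective ((LinearMap.ker g).liftQ g le_rfl) := by
        rw [← LinearMap.ker_eq_bot, Submodule.ker_liftQ_eq_bot _ _ _ le_rfl]
      let c₀ : CharacterModule (M ⧸ LinearMap.ker g) :=
        QuotientAddGroup.lift _ c <| fun b hb ↦ by
          obtain ⟨a, rfl⟩ := (h b).1 hb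
          exact congr($hc a)
      obtain ⟨c', hc'⟩ := dual_surjective_of_injective _ hinj c₀
      exact ⟨c', by ext b; exact congr($hc' (Submodule.Quotient.mk b))⟩
    · rintro ⟨c', rfl⟩
      rw [← LinearMap.comp_apply, ← dual_comp, hgf, dual_zero, LinearMap.zero_apply]

/-- `Tor` vanishes exactly when the corresponding `Ext` into the character module does. -/
lemma subsingleton_tor_succ_iff_ext (X Y : ModuleCat.{u} A) (i : ℕ) :
    Subsingleton (((Tor (ModuleCat.{u} A) (i + 1)).obj X).obj Y) ↔
      Subsingleton (Ext Y (ModuleCat.of A (CharacterModule X)) (i + 1)) := by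
  let P := ProjectiveResolution.of Y
  have hdd : (P.complex.d (i + 1) i).hom ∘ₗ (P.complex.d (i + 2) (i + 1)).hom = 0 :=
    congr(($(P.complex.d_comp_d (i + 2) (i + 1) i)).hom)
  have hT : Subsingleton (((Tor (ModuleCat.{u} A) (i + 1)).obj X).obj Y) ↔
      Function.Exact ((P.complex.d (i + 2) (i + 1)).hom.rTensor X)
        ((P.complex.d (i + 1) i).hom.rTensor X) := by
    rw [← ModuleCat.isZero_iff_subsingleton]
    refine ((P.isoLeftDerivedObj ((MonoidalCategory.tensoringLeft (ModuleCat.{u} A)).obj X)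
      (i + 1)).isZero_iff).trans ?_
    refine (HomologicalComplex.exactAt_iff_isZero_homology _ _).symm.trans ?_
    rw [HomologicalComplex.exactAt_iff' _ (i + 2) (i + 1) i (by simp) (by simp),
      ShortComplex.ShortExact.moduleCat_exact_iff_function_exact]
    change Function.Exact ((P.complex.d (i + 2) (i + 1)).hom.lTensor X)
        ((P.complex.d (i + 1) i).hom.lTensor X) ↔ _
    refine (Function.Exact.iff_of_ladder_linearEquiv
      (e₁ := TensorProduct.comm A (P.complex.X (i + 2)) X)
      (e₂ := TensorProduct.comm A (P.complex.X (i + 1)) X)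
      (e₃ := TensorProduct.comm A (P.complex.X i) X) ?_ ?_)
    all_goals exact TensorProduct.ext' fun _ _ ↦ rfl
  rw [hT, ← CharacterModule.exact_dual_iff (by rw [← LinearMap.rTensor_comp, hdd,
    LinearMap.rTensor_zero])]
  have hE : Function.Exact (CharacterModule.dual ((P.complex.d (i + 1) i).hom.rTensor X))
      (CharacterModule.dual ((P.complex.d (i + 2) (i + 1)).hom.rTensor X)) ↔
      Function.Exact ((P.complex.d (i + 1) i).hom.lcomp A (CharacterModule X))
      ((P.complex.d (i + 2) (i + 1)).hom.lcomp A (CharacterModule X)) := by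
    refine (Function.Exact.iff_of_ladder_linearEquiv (e₁ := CharacterModule.homEquiv)
      (e₂ := CharacterModule.homEquiv) (e₃ := CharacterModule.homEquiv) ?_ ?_)
    all_goals
      rw [← CharacterModule.dual_rTensor_conj_homEquiv]
      ext1 φ
      simp
      rfl
  rw [hE]
  constructor
  · refine fun h ↦ subsingleton_of_forall_eq 0 fun e ↦ ?_
    obtain ⟨f, hf, rfl⟩ := P.extMk_surjective e (i + 2) rfl
    rw [P.extMk_eq_zero_iff _ _ _ _ i rfl]
    obtain ⟨g, hg⟩ := (h f.hom).1 congr(($hf).hom)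
    exact ⟨ModuleCat.ofHom g, by ext1; exact hg⟩
  · refine fun h φ ↦ ⟨fun hφ ↦ ?_, ?_⟩
    · have hφ' : P.complex.d (i + 2) (i + 1) ≫ ModuleCat.ofHom φ = 0 := by ext1; exact hφ
      obtain ⟨g, hg⟩ := (P.extMk_eq_zero_iff (ModuleCat.ofHom φ) (i + 2) rfl hφ' i rfl).1
        (h.elim _ _)
      exact ⟨g.hom, congr(($hg).hom)⟩
    · rintro ⟨ψ, rfl⟩
      change ψ ∘ₗ _ ∘ₗ _ = 0
      rw [hdd, LinearMap.comp_zero]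

end Character

section ChangeOfRings

open Abelian

variable {R S : Type u} [CommRing R] [CommRing S] [Algebra R S] {x : R}

/-- The coefficientwise reduction of finitely supported functions. -/
lemma Finsupp.mapRange_algebraMap_eq_zero_iff (hxS : ∀ r : R, algebraMap R S r = 0 ↔ x ∣ r)
    {ι : Type*} (w : ι →₀ R) :
    Finsupp.mapRange.linearMap (Algebra.linearMap R S) w = 0 ↔ ∃ w', x • w' = w := by
  constructor
  · intro hw
    have hd : ∀ k, x ∣ w k := fun k ↦ (hxS _).1 (DFunLike.congr_fun hw k)
    choose c hc using hd
    refine ⟨∑ k ∈ w.support, Finsupp.single k (c k), ?_⟩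
    conv_rhs => rw [← Finsupp.sum_single w, Finsupp.sum]
    rw [Finset.smul_sum]
    refine Finset.sum_congr rfl fun k _ ↦ ?_
    rw [Finsupp.smul_single, smul_eq_mul, ← hc k]
  · rintro ⟨w', rfl⟩
    ext k
    exact (hxS _).2 (by simp)

/-- A linear map into an `R/(x)`-module kills the multiples of `x`. -/
lemma ker_le_ker_of_eq_smul (hxS : ∀ r : R, algebraMap R S r = 0 ↔ x ∣ r)
    {K K' W : Type*} [AddCommGroup K] [Module R K] [AddCommGroup K'] [Module R K']
    [AddCommGroup W] [Module R W] [Module S W] [IsScalarTower R S W]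
    {π : K →ₗ[R] K'} (hπx : ∀ k, π k = 0 ↔ ∃ k', x • k' = k) (φ : K →ₗ[R] W) :
    LinearMap.ker π ≤ LinearMap.ker φ := fun w hw ↦ by
  obtain ⟨w', rfl⟩ := (hπx w).1 hw
  rw [LinearMap.mem_ker, map_smul, ← algebraMap_smul S x, (hxS x).2 dvd_rfl, zero_smul]

/-- A linear map into an `S`-module that kills the kernel of a surjection onto an `S`-module
factors `S`-linearly, when `R → S` is surjective. -/
lemma exists_linearMap_comp_eq_of_ker_le (hS : Function.Surjective (algebraMap R S))
    {K K' W : Type*} [AddCommGroup K] [Module R K]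
    [AddCommGroup K'] [Module R K'] [Module S K'] [IsScalarTower R S K']
    [AddCommGroup W] [Module R W] [Module S W] [IsScalarTower R S W]
    (π : K →ₗ[R] K') (hπ : Function.Surjective π) (φ : K →ₗ[R] W)
    (h : LinearMap.ker π ≤ LinearMap.ker φ) : ∃ φ' : K' →ₗ[S] W, ∀ k, φ' (π k) = φ k := by
  refine ⟨LinearMap.extendScalarsOfSurjective hS
      ((LinearMap.ker π).liftQ φ h ∘ₗ (π.quotKerEquivOfSurjective hπ).symm.toLinearMap),
      fun k ↦ ?_⟩
  change (LinearMap.ker π).liftQ φ h ((π.quotKerEquivOfSurjective hπ).symm (π k)) = _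
  have : (π.quotKerEquivOfSurjective hπ).symm (π k) = Submodule.Quotient.mk k := by
    rw [LinearEquiv.symm_apply_eq]; rfl
  rw [this, Submodule.liftQ_apply]

/-- If `F/xF → K/xK` is the reduction of a surjection `p : F → K` and `x` is a non zero-divisor
on `K`, then its kernel is the reduction of `ker p`. -/
lemma exists_ker_reduction {F F' K K' : Type*} [AddCommGroup F] [Module R F]
    [AddCommGroup F'] [Module R F'] [Module S F'] [IsScalarTower R S F']
    [AddCommGroup K] [Module R K]
    [AddCommGroup K'] [Module R K'] [Module S K'] [IsScalarTower R S K']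
    (hK : IsSMulRegular K x) {p : F →ₗ[R] K} (hp : Function.Surjective p) {p' : F' →ₗ[S] K'}
    {q : F →ₗ[R] F'} (hq : Function.Surjective q) (hqx : ∀ w, q w = 0 ↔ ∃ w', x • w' = w)
    {π : K →ₗ[R] K'} (hπx : ∀ k, π k = 0 ↔ ∃ k', x • k' = k) (hpq : ∀ w, p' (q w) = π (p w)) :
    ∃ π' : LinearMap.ker p →ₗ[R] LinearMap.ker p', Function.Surjective π' ∧
      (∀ k, π' k = 0 ↔ ∃ k', x • k' = k) ∧ ∀ k, (π' k : F') = q k := by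
  let π' : LinearMap.ker p →ₗ[R] LinearMap.ker p' :=
    LinearMap.codRestrict ((LinearMap.ker p').restrictScalars R) (q ∘ₗ (LinearMap.ker p).subtype)
      fun w ↦ by simp [hpq]
  refine ⟨π', ?_, ?_, fun _ ↦ rfl⟩
  · rintro ⟨v, hv⟩
    obtain ⟨w, rfl⟩ := hq v
    rw [LinearMap.mem_ker, hpq, hπx] at hv
    obtain ⟨k, hk⟩ := hv
    obtain ⟨w', rfl⟩ := hp k
    refine ⟨⟨w - x • w', by simp [hk]⟩, Subtype.ext ?_⟩
    have : q (x • w') = 0 := (hqx _).2 ⟨w', rfl⟩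
    change q (w - x • w') = q w
    rw [map_sub, this, sub_zero]
  · rintro ⟨w, hw⟩
    refine ⟨fun h0 ↦ ?_, ?_⟩
    · obtain ⟨w', rfl⟩ := (hqx w).1 congr(($h0).1)
      exact ⟨⟨w', hK (by simpa using hw)⟩, rfl⟩
    · rintro ⟨w', hw'⟩
      exact Subtype.ext ((hqx w).2 ⟨w'.1, congr(($hw').1)⟩)

/-- Reduction is compatible with linear combinations. -/
lemma Finsupp.linearCombination_mapRange_algebraMap {K K' : Type*} [AddCommGroup K] [Module R K]
    [AddCommGroup K'] [Module R K'] [Module S K'] [IsScalarTower R S K'] (π : K →ₗ[R] K')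
    (w : K →₀ R) :
    Finsupp.linearCombination S π (Finsupp.mapRange.linearMap (Algebra.linearMap R S) w) =
      π (Finsupp.linearCombination R id w) := by
  induction w using Finsupp.induction_linear with
  | zero => simp
  | add v w hv hw => simp only [map_add, hv, hw]
  | single k r => simp

/-- There are free presentations of `K` and `K/xK` such that the second one and its kernel are the
reductions of the first one and its kernel. -/
lemma exists_presentation_reduction (hS : Function.Surjective (algebraMap R S))
    (hxS : ∀ r : R, algebraMap R S r = 0 ↔ x ∣ r) {K K' : Type*}
    [AddCommGroup K] [Module R K] [AddCommGroup K'] [Module R K'] [Module S K']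
    [IsScalarTower R S K'] (hK : IsSMulRegular K x) (π : K →ₗ[R] K')
    (hπ : Function.Surjective π) (hπx : ∀ k, π k = 0 ↔ ∃ k', x • k' = k) :
    ∃ (p : (K →₀ R) →ₗ[R] K) (p' : (K →₀ S) →ₗ[S] K') (q : (K →₀ R) →ₗ[R] (K →₀ S))
      (π' : LinearMap.ker p →ₗ[R] LinearMap.ker p'),
      Function.Surjective p ∧ Function.Surjective p' ∧ Function.Surjective π' ∧
        (∀ k, π' k = 0 ↔ ∃ k', x • k' = k) ∧ ∀ k, (π' k : K →₀ S) = q k := by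
  obtain ⟨π', hπ', hπx', hπq⟩ := exists_ker_reduction hK
    (Finsupp.linearCombination_id_surjective R K)
    (Finsupp.mapRange_surjective _ (map_zero _) hS)
    (Finsupp.mapRange_algebraMap_eq_zero_iff hxS) hπx
    (Finsupp.linearCombination_mapRange_algebraMap π)
  refine ⟨_, _, _, π', Finsupp.linearCombination_id_surjective R K, fun k' ↦ ?_, hπ', hπx', hπq⟩
  obtain ⟨k, rfl⟩ := hπ k'
  exact ⟨Finsupp.single k 1, by simp⟩

/-- Maps into an `R/(x)`-module extend along a linear map if they extend along its reduction. -/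
lemma surjective_lcomp_of_reduction (hS : Function.Surjective (algebraMap R S))
    (hxS : ∀ r : R, algebraMap R S r = 0 ↔ x ∣ r)
    {L L' F F' : Type*} [AddCommGroup L] [Module R L] [AddCommGroup F] [Module R F]
    [AddCommGroup L'] [Module R L'] [Module S L'] [IsScalarTower R S L']
    [AddCommGroup F'] [Module R F'] [Module S F'] [IsScalarTower R S F']
    (f : L →ₗ[R] F) (f' : L' →ₗ[S] F')
    (W : Type*) [AddCommGroup W] [Module R W] [Module S W] [IsScalarTower R S W]
    (q : F →ₗ[R] F') {π : L →ₗ[R] L'} (hπ : Function.Surjective π)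
    (hπx : ∀ k, π k = 0 ↔ ∃ k', x • k' = k) (hπq : ∀ k, f' (π k) = q (f k))
    (h : Function.Surjective (f'.lcomp S W)) : Function.Surjective (f.lcomp R W) := by
  intro φ
  obtain ⟨φ', hφ'⟩ := exists_linearMap_comp_eq_of_ker_le hS π hπ φ
    (ker_le_ker_of_eq_smul hxS hπx φ)
  obtain ⟨ψ, rfl⟩ := h φ'
  refine ⟨ψ.restrictScalars R ∘ₗ q, LinearMap.ext fun w ↦ ?_⟩
  rw [← hφ']
  exact congr(ψ $((hπq w).symm))

/-- If `x` is a non zero-divisor on `K` and `S = R/(x)`, then vanishing of `Ext_S(K/xK, W)` implies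
vanishing of `Ext_R(K, W)` for every `S`-module `W`. -/
lemma subsingleton_ext_of_subsingleton_ext_quotient
    (hS : Function.Surjective (algebraMap R S))
    (hxS : ∀ r : R, algebraMap R S r = 0 ↔ x ∣ r) (hx : IsSMulRegular R x)
    (W : Type u) [AddCommGroup W] [Module R W] [Module S W] [IsScalarTower R S W] (i : ℕ)
    (K K' : Type u) [AddCommGroup K] [Module R K] [AddCommGroup K'] [Module R K'] [Module S K']
    [IsScalarTower R S K'] (hK : IsSMulRegular K x) (π : K →ₗ[R] K') (hπ : Function.Surjective π)
    (hπx : ∀ k, π k = 0 ↔ ∃ k', x • k' = k)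
    (h : Subsingleton (Ext (ModuleCat.of S K') (ModuleCat.of S W) (i + 1))) :
    Subsingleton (Ext (ModuleCat.of R K) (ModuleCat.of R W) (i + 1)) := by
  obtain ⟨p, p', q, π', hp, hp', hπ', hπx', hπq⟩ :=
    exists_presentation_reduction hS hxS hK π hπ hπx
  cases i with
  | zero =>
    rw [zero_add, subsingleton_ext_one_iff_of_projective _ (Submodule.injective_subtype _) hp
      (LinearMap.exact_subtype_ker_map _)]
    rw [zero_add, subsingleton_ext_one_iff_of_projective _ (Submodule.injective_subtype _) hp'
      (LinearMap.exact_subtype_ker_map _)] at h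
    refine surjective_lcomp_of_reduction (L := LinearMap.ker p) (L' := LinearMap.ker p') hS hxS
      (LinearMap.ker p).subtype (LinearMap.ker p').subtype W q (π := π') hπ' ?_ ?_ ?_
    · exact hπx'
    · exact hπq
    · exact h
  | succ i =>
    rw [subsingleton_ext_succ_iff_of_projective _ (Submodule.injective_subtype _) hp
      (LinearMap.exact_subtype_ker_map _)]
    rw [subsingleton_ext_succ_iff_of_projective _ (Submodule.injective_subtype _) hp'
      (LinearMap.exact_subtype_ker_map _)] at h
    exact subsingleton_ext_of_subsingleton_ext_quotient hS hxS hx W i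
      (LinearMap.ker p) (LinearMap.ker p')
      (fun v w hvw ↦ Subtype.ext (Finsupp.ext fun k ↦ hx (DFunLike.congr_fun congr(($hvw).1) k)))
      π' hπ' hπx' h
termination_by i

/-- If `S = R/(x)` with `x` a non zero-divisor, then vanishing of `Ext_S(N, W)` in two consecutive
positive degrees implies vanishing of `Ext_R(N, W)` in the higher one. -/
lemma subsingleton_ext_of_subsingleton_ext_of_quotient_span (hx : IsSMulRegular R x)
    (N W : Type u) [AddCommGroup W] [Module R W] [Module (R ⧸ Ideal.span {x}) W]
    [IsScalarTower R (R ⧸ Ideal.span {x}) W] [AddCommGroup N] [Module R N]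
    [Module (R ⧸ Ideal.span {x}) N] [IsScalarTower R (R ⧸ Ideal.span {x}) N] (i : ℕ)
    (h₁ : Subsingleton (Ext (ModuleCat.of (R ⧸ Ideal.span {x}) N)
      (ModuleCat.of (R ⧸ Ideal.span {x}) W) (i + 1)))
    (h₂ : Subsingleton (Ext (ModuleCat.of (R ⧸ Ideal.span {x}) N)
      (ModuleCat.of (R ⧸ Ideal.span {x}) W) (i + 2))) :
    Subsingleton (Ext (ModuleCat.of R N) (ModuleCat.of R W) (i + 2)) := by
  have hS : Function.Surjective (algebraMap R (R ⧸ Ideal.span {x})) :=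
    Ideal.Quotient.mk_surjective
  have hxS : ∀ r : R, algebraMap R (R ⧸ Ideal.span {x}) r = 0 ↔ x ∣ r := fun r ↦ by
    rw [Ideal.Quotient.algebraMap_eq, Ideal.Quotient.eq_zero_iff_mem, Ideal.mem_span_singleton]
  have hp := Finsupp.linearCombination_id_surjective R N
  have hp' := Finsupp.linearCombination_id_surjective (R ⧸ Ideal.span {x}) N
  have hpq := Finsupp.linearCombination_mapRange_algebraMap (S := R ⧸ Ideal.span {x})
    (LinearMap.id : N →ₗ[R] N)
  have hqx := Finsupp.mapRange_algebraMap_eq_zero_iff hxS (ι := N)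
  have hq : Function.Surjective (Finsupp.mapRange.linearMap (α := N)
    (Algebra.linearMap R (R ⧸ Ideal.span {x}))) :=
    Finsupp.mapRange_surjective _ (map_zero _) hS
  rw [subsingleton_ext_succ_iff_of_projective _ (Submodule.injective_subtype _) hp
    (LinearMap.exact_subtype_ker_map _)]
  rw [subsingleton_ext_succ_iff_of_projective _ (Submodule.injective_subtype _) hp'
    (LinearMap.exact_subtype_ker_map _)] at h₂
  generalize Finsupp.mapRange.linearMap (α := N)
    (Algebra.linearMap R (R ⧸ Ideal.span {x})) = q at *
  change ∀ w, Finsupp.linearCombination (R ⧸ Ideal.span {x}) id (q w) = _ at hpq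
  have hpx : ∀ w, x • w ∈ LinearMap.ker (Finsupp.linearCombination R (id : N → N)) := fun w ↦ by
    rw [LinearMap.mem_ker, map_smul, ← algebraMap_smul (R ⧸ Ideal.span {x}) x,
      (hxS x).2 dvd_rfl, zero_smul]
  generalize Finsupp.linearCombination (R ⧸ Ideal.span {x}) (id : N → N) = p' at *
  have hreg : IsSMulRegular (N →₀ R) x := fun v w hvw ↦
    Finsupp.ext fun k ↦ hx congr($hvw k)
  generalize Finsupp.linearCombination R (id : N → N) = p at *
  let ρ : LinearMap.ker p →ₗ[R] QuotSMulTop x (LinearMap.ker p) := Submodule.mkQ _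
  have hρ : Function.Surjective ρ := Submodule.mkQ_surjective _
  have hρx : ∀ k, ρ k = 0 ↔ ∃ k', x • k' = k := fun k ↦ by
    simp [ρ, Submodule.mem_smul_pointwise_iff_exists]
  refine subsingleton_ext_of_subsingleton_ext_quotient hS hxS hx W i _ _
    (fun v w hvw ↦ Subtype.ext (hreg congr(($hvw).1))) ρ hρ hρx ?_
  obtain ⟨α, hα⟩ := exists_linearMap_comp_eq_of_ker_le hS p hp
    (ρ ∘ₗ LinearMap.codRestrict (LinearMap.ker p) (LinearMap.lsmul R _ x) hpx) fun w hw ↦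
      (hρx _).2 ⟨⟨w, hw⟩, rfl⟩
  let β₀ : LinearMap.ker p →ₗ[R] LinearMap.ker p' :=
    LinearMap.codRestrict ((LinearMap.ker p').restrictScalars R)
      (q ∘ₗ (LinearMap.ker p).subtype) fun w ↦ by simp [hpq]
  have hβ₀ : LinearMap.ker ρ ≤ LinearMap.ker β₀ := fun w hw ↦ by
    obtain ⟨w', rfl⟩ := (hρx w).1 hw
    exact Subtype.ext ((hqx _).2 ⟨w', rfl⟩)
  obtain ⟨β, hβ⟩ := exists_linearMap_comp_eq_of_ker_le (R := R) (S := R ⧸ Ideal.span {x})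
    (K := LinearMap.ker p) (K' := QuotSMulTop x (LinearMap.ker p)) (W := LinearMap.ker p')
    hS ρ hρ β₀ hβ₀
  refine subsingleton_ext_of_shortExact W (f := α) (g := β) ?_ ?_ ?_ _ h₁ h₂
  · rw [injective_iff_map_eq_zero]
    intro n hn
    obtain ⟨w, rfl⟩ := hp n
    rw [hα] at hn
    obtain ⟨w', hw'⟩ := (hρx _).1 hn
    rw [← hreg congr(($hw').1)]
    exact w'.2
  · rintro ⟨v, hv⟩
    obtain ⟨w, rfl⟩ := hq v
    exact ⟨ρ ⟨w, (hpq w).symm.trans hv⟩, (hβ _).trans rfl⟩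
  · intro k
    obtain ⟨k, rfl⟩ := hρ k
    rw [hβ]
    refine ⟨fun h ↦ ?_, ?_⟩
    · obtain ⟨w, hw⟩ := (hqx _).1 congr(($h).1)
      exact ⟨p w, (hα w).trans congr(ρ $(Subtype.ext hw))⟩
    · rintro ⟨n, hn⟩
      obtain ⟨w, rfl⟩ := hp n
      rw [hα] at hn
      have := congr(β $hn)
      rw [hβ] at this
      rw [← this]
      change β (ρ _) = 0
      rw [hβ]
      exact Subtype.ext ((hqx _).2 ⟨w, rfl⟩)

end ChangeOfRings

/-- Let `(R,𝔪,k)` be a commutative noetherian local ring, `x ∈ 𝔪` a non zero-divisor on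
`R`, and `N` a finitely generated `R/(x)`-module with `Tor_i^{R/(x)}(N,N) = 0` for all
sufficiently large `i`.  Then `Tor_i^R(N,N) = 0` for all sufficiently large `i`, where
`N` is regarded as an `R`-module via the quotient map `R → R/(x)`. -/
theorem tor_vanishing_descends_along_quotient_by_nzd
    {R : Type u} [CommRing R] [IsNoetherianRing R] [IsLocalRing R]
    (x : R) (hxm : x ∈ IsLocalRing.maximalIdeal R) (hx : x ∈ nonZeroDivisors R)
    (N : ModuleCat.{u} (R ⧸ Ideal.span {x}))
    (hfin : Module.Finite (R ⧸ Ideal.span {x}) N)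
    (hvan : ∃ N₀ : ℕ, ∀ i, N₀ ≤ i →
      Subsingleton (((Tor (ModuleCat.{u} (R ⧸ Ideal.span {x})) i).obj N).obj N)) :
    ∃ N₀ : ℕ, ∀ i, N₀ ≤ i →
      Subsingleton (((Tor (ModuleCat.{u} R) i).obj
          ((ModuleCat.restrictScalars (Ideal.Quotient.mk (Ideal.span {x}))).obj N)).obj
        ((ModuleCat.restrictScalars (Ideal.Quotient.mk (Ideal.span {x}))).obj N)) := by
  obtain ⟨n, hn⟩ := hvan
  refine ⟨n + 2, fun i hi ↦ ?_⟩
  obtain ⟨j, rfl⟩ := Nat.exists_eq_add_of_le' (le_of_add_le_right hi)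
  let : Module R N := Module.compHom N (Ideal.Quotient.mk (Ideal.span {x}))
  have : IsScalarTower R (R ⧸ Ideal.span {x}) N := .of_algebraMap_smul fun _ _ ↦ rfl
  have : IsScalarTower R (R ⧸ Ideal.span {x}) (CharacterModule N) :=
    .of_algebraMap_smul fun _ _ ↦ rfl
  have hxr : IsSMulRegular R x := (isRegular_iff_mem_nonZeroDivisors.2 hx).left
  exact (subsingleton_tor_succ_iff_ext (ModuleCat.of R N) (ModuleCat.of R N) (j + 1)).2 <|
    subsingleton_ext_of_subsingleton_ext_of_quotient_span hxr N (CharacterModule N) j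
      ((subsingleton_tor_succ_iff_ext N N j).1 (hn _ (by lia)))
      ((subsingleton_tor_succ_iff_ext N N (j + 1)).1 (hn _ (by lia)))
end
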